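/- arXiv:1407.3093 — 7 statements merged into one kernel-verified Lean document; each statement's English description precedes it below -/
import Mathlib

section
/- Let K be a field, V an infinite-dimensional K-vector space and φ : V → V a K-linear endomorphism. Then the following are equivalent: (1) for every subspace H of V, the quotient (H + φ(H))/H is finite-dimensional; (2) there exist a scalar c ∈ K and a subspace W of V with finite-dimensional quotient V/W such that φ(x) = c·x for all x ∈ W. -/
open Submodule in
/-- If `x` and `φ x` are linearly dependent modulo a finite-dimensional subspace `F` for all `x`,
then `φ` differs from a homothety by a map of finite rank. -/
theorem LinearMap.exists_finiteDimensional_range_sub_smul {K V : Type*} [Field K]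
    [AddCommGroup V] [Module K V] (φ : V →ₗ[K] V) (F : Submodule K V) [FiniteDimensional K F]
    (h : ∀ x, ¬ LinearIndependent K ![F.mkQ x, F.mkQ (φ x)]) :
    ∃ c : K, FiniteDimensional K (LinearMap.range (φ - c • LinearMap.id)) := by
  obtain ⟨s, hs⟩ := F.mkQ.exists_rightInverse_of_surjective F.range_mkQ
  have hs' (q : V ⧸ F) : F.mkQ (s q) = q := LinearMap.congr_fun hs q
  obtain ⟨c, hc⟩ := LinearMap.exists_eq_smul_id_of_forall_notLinearIndependent
    (f := F.mkQ ∘ₗ φ ∘ₗ s) fun q ↦ by simpa [hs'] using! h (s q)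
  refine ⟨c, ?_⟩
  set ψ : V →ₗ[K] V := φ - c • LinearMap.id
  have hψs (q : V ⧸ F) : ψ (s q) ∈ F := by
    refine (Quotient.mk_eq_zero F).1 ?_
    change F.mkQ _ = 0
    have := LinearMap.congr_fun hc q
    simp only [LinearMap.comp_apply, LinearMap.smul_apply, Module.End.one_apply] at this
    simp only [ψ, LinearMap.sub_apply, LinearMap.smul_apply, LinearMap.id_apply, map_sub,
      map_smul, hs', this, sub_self]
  refine finiteDimensional_of_le (S₂ := F ⊔ F.map ψ) ?_
  rintro _ ⟨x, rfl⟩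
  have hx : x - s (F.mkQ x) ∈ F := by
    refine (Quotient.mk_eq_zero F).1 ?_
    change F.mkQ _ = 0
    rw [map_sub, hs', sub_self]
  rw [← add_sub_cancel (s (F.mkQ x)) x, map_add]
  exact add_mem_sup (hψs _) (mem_map_of_mem hx)

/-- If modulo every finite-dimensional subspace some `x`, `φ x` are linearly independent, then
there is a sequence `x` such that the `x i` and `φ (x i)` together are linearly independent. -/
theorem LinearMap.exists_seq_sum_smul_add_smul_eq_zero_imp {K V : Type*} [Field K]
    [AddCommGroup V] [Module K V] (φ : V →ₗ[K] V)
    (h : ∀ F : Submodule K V, FiniteDimensional K F →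
      ∃ x, LinearIndependent K ![F.mkQ x, F.mkQ (φ x)]) :
    ∃ x : ℕ → V, ∀ (n : ℕ) (a b : ℕ → K),
      ∑ i ∈ Finset.range n, (a i • x i + b i • φ (x i)) = 0 → ∀ i < n, a i = 0 ∧ b i = 0 := by
  choose f hf using fun F : {F : Submodule K V // FiniteDimensional K F} ↦ h F.1 F.2
  let G : ℕ → {F : Submodule K V // FiniteDimensional K F} := fun n ↦
    n.rec ⟨⊥, inferInstance⟩ fun _ F ↦
      ⟨F.1 ⊔ (Submodule.span K {f F} ⊔ Submodule.span K {φ (f F)}),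
        have := F.2; inferInstance⟩
  have hG (n : ℕ) : (G (n + 1)).1 = (G n).1 ⊔
      (Submodule.span K {f (G n)} ⊔ Submodule.span K {φ (f (G n))}) := rfl
  have hsum (a b : ℕ → K) (n : ℕ) :
      ∑ i ∈ Finset.range n, (a i • f (G i) + b i • φ (f (G i))) ∈ (G n).1 := by
    induction n with
    | zero => simp
    | succ n ih =>
      rw [Finset.sum_range_succ, hG]
      exact Submodule.add_mem_sup ih (Submodule.add_mem_sup
        (Submodule.smul_mem _ _ (Submodule.mem_span_singleton_self _))
        (Submodule.smul_mem _ _ (Submodule.mem_span_singleton_self _)))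
  refine ⟨fun n ↦ f (G n), fun n a b ↦ ?_⟩
  induction n with
  | zero => simp
  | succ n ih =>
    intro h0
    rw [Finset.sum_range_succ] at h0
    have hmem : a n • f (G n) + b n • φ (f (G n)) ∈ (G n).1 := by
      rw [← neg_eq_of_add_eq_zero_right h0]
      exact neg_mem (hsum a b n)
    have hn : a n = 0 ∧ b n = 0 := by
      refine LinearIndependent.pair_iff.1 (hf (G n)) _ _ ?_
      rwa [← Submodule.ker_mkQ (G n).1, LinearMap.mem_ker, map_add, map_smul, map_smul] at hmem
    rw [hn.1, hn.2, zero_smul, zero_smul, add_zero, add_zero] at h0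
    intro i hi
    obtain hi | rfl := Nat.lt_succ_iff_lt_or_eq.1 hi
    · exact ih h0 i hi
    · exact hn

open Submodule in
/-- If `(H + φ(H))/H` is finite-dimensional for all subspaces `H`, then `φ` differs from a
homothety by a map of finite rank. -/
theorem LinearMap.exists_finiteDimensional_range_sub_smul_of_forall_map_mkQ
    {K V : Type*} [Field K] [AddCommGroup V] [Module K V] (φ : V →ₗ[K] V)
    (h : ∀ H : Submodule K V, FiniteDimensional K ((H ⊔ H.map φ).map H.mkQ)) :
    ∃ c : K, FiniteDimensional K (LinearMap.range (φ - c • LinearMap.id)) := by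
  by_contra hc
  obtain ⟨x, hx⟩ := φ.exists_seq_sum_smul_add_smul_eq_zero_imp fun F hF ↦ by
    by_contra! hF'
    exact hc (φ.exists_finiteDimensional_range_sub_smul F hF')
  set H := span K (Set.range x)
  have := h H
  have hmem (i : ℕ) : H.mkQ (φ (x i)) ∈ (H ⊔ H.map φ).map H.mkQ :=
    mem_map_of_mem (mem_sup_right (mem_map_of_mem (subset_span ⟨i, rfl⟩)))
  refine Module.Finite.not_linearIndependent_of_infinite (R := K)
    (fun i : ℕ ↦ (⟨H.mkQ (φ (x i)), hmem i⟩ : (H ⊔ H.map φ).map H.mkQ)) ?_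
  refine LinearIndependent.of_comp (Submodule.subtype _) ?_
  rw [linearIndependent_iff]
  intro b hb
  have hb' : b.sum (fun i r ↦ r • φ (x i)) ∈ H := by
    rw [← ker_mkQ H, LinearMap.mem_ker, map_finsuppSum]
    simpa [Finsupp.linearCombination_apply] using hb
  obtain ⟨a, ha⟩ := Finsupp.mem_span_range_iff_exists_finsupp.1 hb'
  obtain ⟨n, hn⟩ := (a.support ∪ b.support).exists_nat_subset_range
  rw [Finsupp.sum_of_support_subset a (Finset.subset_union_left.trans hn) _ (by simp),
    Finsupp.sum_of_support_subset b (Finset.subset_union_right.trans hn) _ (by simp)] at ha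
  have hzero := hx n (-a) b (by simp [Finset.sum_add_distrib, ha])
  ext i
  by_contra hi
  exact hi (hzero i (Finset.mem_range.1
    (hn (Finset.mem_union_right _ (Finsupp.mem_support_iff.2 hi))))).2

/-- Let `K` be a field, `V` an infinite-dimensional `K`-vector space and
`φ : V → V` a `K`-linear endomorphism.  The following are equivalent:
(1) for every subspace `H` of `V`, the quotient `(H + φ(H))/H` is finite-dimensional;
(2) there exist a scalar `c ∈ K` and a subspace `W` of `V` with finite-dimensional quotient
`V/W` such that `φ x = c • x` for all `x ∈ W`. -/
theorem inertial_linear_sup_iff_scalar_on_finite_codim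
    (K : Type*) [Field K] (V : Type*) [AddCommGroup V] [Module K V]
    (hV : ¬ FiniteDimensional K V) (φ : V →ₗ[K] V) :
    (∀ H : Submodule K V,
        FiniteDimensional K ((H ⊔ H.map φ).map H.mkQ)) ↔
    (∃ (c : K) (W : Submodule K V),
        FiniteDimensional K (V ⧸ W) ∧ ∀ x ∈ W, φ x = c • x) := by
  constructor
  · intro h
    obtain ⟨c, hc⟩ := φ.exists_finiteDimensional_range_sub_smul_of_forall_map_mkQ h
    refine ⟨c, LinearMap.ker (φ - c • LinearMap.id),
      (LinearMap.quotKerEquivRange _).symm.finiteDimensional, fun x hx ↦ ?_⟩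
    simpa [sub_eq_zero] using hx
  · rintro ⟨c, W, hW, hφ⟩ H
    set ψ : V →ₗ[K] V := φ - c • LinearMap.id
    have hψ : W ≤ LinearMap.ker ψ := fun x hx ↦ by simp [ψ, hφ x hx]
    have : FiniteDimensional K (LinearMap.range ψ) := by
      rw [← W.range_liftQ ψ hψ]
      infer_instance
    refine Submodule.finiteDimensional_of_le (S₂ := (LinearMap.range ψ).map H.mkQ) ?_
    rw [Submodule.map_sup, sup_le_iff]
    constructor
    · simp
    · rintro _ ⟨_, ⟨x, hx, rfl⟩, rfl⟩
      refine ⟨ψ x, ⟨x, rfl⟩, ?_⟩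
      have : H.mkQ x = 0 := by rwa [← LinearMap.mem_ker, Submodule.ker_mkQ]
      simp only [ψ, LinearMap.sub_apply, LinearMap.smul_apply, LinearMap.id_apply, map_sub,
        map_smul, this, smul_zero, sub_zero]
end

section
/- Let K be a field, V an infinite-dimensional K-vector space and φ : V → V a K-linear endomorphism. Then the following are equivalent: (1) for every subspace H of V, the quotient H/(H ∩ φ(H)) is finite-dimensional; (2) there exist a nonzero scalar c ∈ K and a subspace W of V with finite-dimensional quotient V/W such that φ(x) = c·x for all x ∈ W. -/
section

variable {K V : Type*} [Field K] [AddCommGroup V] [Module K V]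

/-- If no `x` is independent of `φ x` modulo a finite-dimensional subspace `F` of an
infinite-dimensional space, then `φ` is a scalar modulo `F`. -/
theorem exists_sub_smul_mem_of_dependent_mod (hV : ¬ FiniteDimensional K V) (φ : V →ₗ[K] V)
    (F : Submodule K V) [FiniteDimensional K F]
    (h : ∀ x, ∃ s t : K, s • x + t • φ x ∈ F ∧ ¬ (s = 0 ∧ t = 0)) :
    ∃ c : K, ∀ x, φ x - c • x ∈ F := by
  have eigen : ∀ x ∉ F, ∃ c : K, φ x - c • x ∈ F := by
    intro x hx
    obtain ⟨s, t, hst, h0⟩ := h x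
    have ht : t ≠ 0 := by
      rintro rfl
      have hs : s ≠ 0 := fun hs => h0 ⟨hs, rfl⟩
      exact hx ((F.smul_mem_iff hs).1 (by simpa using hst))
    refine ⟨-(t⁻¹ * s), (F.smul_mem_iff ht).1 ?_⟩
    convert hst using 1
    rw [smul_sub, smul_smul]
    have : t * -(t⁻¹ * s) = -s := by field_simp
    rw [this]; module
  have exists_notMem : ∀ G : Submodule K V, FiniteDimensional K G → ∃ y, y ∉ G := by
    intro G hG
    by_contra! hall
    have : G = ⊤ := (Submodule.eq_top_iff').2 hall
    subst this
    exact hV (Module.Finite.equiv Submodule.topEquiv)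
  have invariant : F ≤ F.comap φ := by
    intro x hx
    obtain ⟨y, hy⟩ := exists_notMem F inferInstance
    have multiple : ∀ z ∉ F, ∃ d : K, φ x - d • z ∈ F := by
      intro z hz
      obtain ⟨c, hc⟩ := eigen z hz
      obtain ⟨c', hc'⟩ := eigen (z + x) (fun h => hz ((F.add_mem_iff_left hx).1 h))
      refine ⟨c' - c, ?_⟩
      have := F.add_mem (F.sub_mem hc' hc) (F.smul_mem c' hx)
      convert this using 1
      rw [map_add]; module
    obtain ⟨z, hz⟩ := exists_notMem (F ⊔ K ∙ y) inferInstance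
    obtain ⟨d, hd⟩ := multiple y hy
    obtain ⟨e, he⟩ := multiple z (fun h => hz (Submodule.mem_sup_left h))
    have he0 : e = 0 := by
      by_contra he0
      apply hz
      refine (Submodule.smul_mem_iff _ he0).1 ?_
      have : e • z = ((φ x - d • y) - (φ x - e • z)) + d • y := by module
      rw [this]
      exact Submodule.add_mem_sup (F.sub_mem hd he)
        (Submodule.smul_mem _ _ (Submodule.mem_span_singleton_self y))
    simpa [he0] using he
  obtain ⟨c, hc⟩ := LinearMap.exists_eq_smul_id_of_forall_notLinearIndependent
    (f := F.mapQ F φ invariant) (by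
      intro v
      obtain ⟨x, rfl⟩ := F.mkQ_surjective v
      obtain ⟨s, t, hst, h0⟩ := h x
      rw [LinearIndependent.pair_iff]
      intro hli
      refine h0 (hli s t ?_)
      simpa using (Submodule.Quotient.mk_eq_zero F).2 hst)
  refine ⟨c, fun x => ?_⟩
  rw [← Submodule.Quotient.mk_eq_zero, Submodule.Quotient.mk_sub, sub_eq_zero]
  simpa using LinearMap.congr_fun hc (F.mkQ x)

/-- If `φ` is not a scalar modulo a finite-dimensional subspace, some infinite-dimensional
subspace is disjoint from its image. -/
theorem exists_infinite_disjoint_map (hV : ¬ FiniteDimensional K V) (φ : V →ₗ[K] V)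
    (h : ∀ F : Submodule K V, FiniteDimensional K F → ∀ c : K, ∃ x, φ x - c • x ∉ F) :
    ∃ H : Submodule K V, ¬ FiniteDimensional K H ∧ H ⊓ H.map φ = ⊥ := by
  let S : Set (Submodule K V) := {H | ∀ a ∈ H, ∀ b ∈ H, a + φ b = 0 → a = 0 ∧ b = 0}
  obtain ⟨H, -, hH⟩ := zorn_le_nonempty₀ S (by
    intro C hCS hC H₀ hH₀
    refine ⟨sSup C, ?_, fun _ => le_sSup⟩
    intro a ha b hb hab
    rw [Submodule.mem_sSup_of_directed ⟨H₀, hH₀⟩ hC.directedOn] at ha hb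
    obtain ⟨A, hA, ha⟩ := ha
    obtain ⟨B, hB, hb⟩ := hb
    obtain ⟨D, hD, hAD, hBD⟩ := hC.directedOn A hA B hB
    exact hCS hD a (hAD ha) b (hBD hb) hab) ⊥ (by
      intro a ha b hb _
      exact ⟨(Submodule.mem_bot K).1 ha, (Submodule.mem_bot K).1 hb⟩)
  refine ⟨H, fun hfin => ?_, ?_⟩
  · have : ∃ x, ∀ s t : K, s • x + t • φ x ∈ H ⊔ H.map φ → s = 0 ∧ t = 0 := by
      by_contra! hdep
      obtain ⟨c, hc⟩ := exists_sub_smul_mem_of_dependent_mod hV φ (H ⊔ H.map φ) (by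
        intro x
        obtain ⟨s, t, hst, h0⟩ := hdep x
        exact ⟨s, t, hst, fun h => h0 h.1 h.2⟩)
      obtain ⟨x, hx⟩ := h (H ⊔ H.map φ) inferInstance c
      exact hx (hc x)
    obtain ⟨x, hx⟩ := this
    have hmem : H ⊔ K ∙ x ∈ S := by
      intro a ha b hb hab
      obtain ⟨a₀, ha₀, u, hu, rfl⟩ := Submodule.mem_sup.1 ha
      obtain ⟨b₀, hb₀, v, hv, rfl⟩ := Submodule.mem_sup.1 hb
      obtain ⟨s, rfl⟩ := Submodule.mem_span_singleton.1 hu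
      obtain ⟨t, rfl⟩ := Submodule.mem_span_singleton.1 hv
      rw [map_add, map_smul] at hab
      obtain ⟨rfl, rfl⟩ := hx s t (by
        have : s • x + t • φ x = -(a₀ + φ b₀) := by
          rw [eq_neg_iff_add_eq_zero, ← hab]; abel
        rw [this]
        exact neg_mem (Submodule.add_mem_sup ha₀ (Submodule.mem_map_of_mem hb₀)))
      simpa using hH.1 a₀ ha₀ b₀ hb₀ (by simpa using hab)
    have hxH : x ∈ H := hH.2 hmem le_sup_left
      (Submodule.mem_sup_right (Submodule.mem_span_singleton_self x))
    exact one_ne_zero (hx 1 0 (by simpa using Submodule.mem_sup_left hxH)).1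
  · rw [eq_bot_iff]
    rintro a ⟨ha, b, hb, rfl⟩
    exact (hH.1 (φ b) ha (-b) (neg_mem hb) (by simp)).1

/-- The image of a subspace in `V ⧸ M` is finite-dimensional as soon as `M` contains the
intersection of that subspace with a subspace of finite codimension. -/
theorem finiteDimensional_map_mkQ_of_inf_le {H W M : Submodule K V} [FiniteDimensional K (V ⧸ W)]
    (h : H ⊓ W ≤ M) : FiniteDimensional K (H.map M.mkQ) := by
  obtain ⟨G, hG⟩ := Submodule.exists_isCompl (W.comap H.subtype)
  have hGfin : FiniteDimensional K G := by
    refine FiniteDimensional.of_injective (W.mkQ ∘ₗ H.subtype ∘ₗ G.subtype) ?_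
    rw [← LinearMap.ker_eq_bot, eq_bot_iff]
    intro g hg
    have hgW : (g : H) ∈ W.comap H.subtype := by simpa using hg
    have := (Submodule.disjoint_def.1 hG.disjoint) g hgW g.2
    simpa using this
  suffices H.map M.mkQ ≤ (G.map H.subtype).map M.mkQ from
    Submodule.finiteDimensional_of_le this
  rintro _ ⟨x, hx, rfl⟩
  obtain ⟨w, hw, g, hg, hwg⟩ :=
    Submodule.mem_sup.1 (hG.sup_eq_top ▸ Submodule.mem_top : (⟨x, hx⟩ : H) ∈ _ ⊔ G)
  refine ⟨g, ⟨g, hg, rfl⟩, ?_⟩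
  have hwM : (w : V) ∈ M := h ⟨w.2, hw⟩
  have hx' : x = w + g := (congrArg Subtype.val hwg).symm
  rw [hx', map_add, Submodule.mkQ_apply M w, (Submodule.Quotient.mk_eq_zero M).2 hwM, zero_add]

end

/-- Let `K` be a field, `V` an infinite-dimensional `K`-vector space and
`φ : V → V` a `K`-linear endomorphism.  The following are equivalent:
(1) for every subspace `H` of `V`, the quotient `H/(H ∩ φ(H))` is finite-dimensional;
(2) there exist a nonzero scalar `c ∈ K` and a subspace `W` of `V` with finite-dimensional
quotient `V/W` such that `φ x = c • x` for all `x ∈ W`. -/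
theorem inertial_linear_inf_iff_nonzero_scalar_on_finite_codim
    (K : Type*) [Field K] (V : Type*) [AddCommGroup V] [Module K V]
    (hV : ¬ FiniteDimensional K V) (φ : V →ₗ[K] V) :
    (∀ H : Submodule K V,
        FiniteDimensional K (H.map (H ⊓ H.map φ).mkQ)) ↔
    (∃ (c : K) (W : Submodule K V), c ≠ 0 ∧
        FiniteDimensional K (V ⧸ W) ∧ ∀ x ∈ W, φ x = c • x) := by
  constructor
  · intro h
    have hscalar : ∃ F : Submodule K V, FiniteDimensional K F ∧
        ∃ c : K, ∀ x, φ x - c • x ∈ F := by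
      by_contra! hno
      obtain ⟨H, hH, hbot⟩ := exists_infinite_disjoint_map hV φ hno
      have hfin := h H
      rw [hbot] at hfin
      refine hH (LinearEquiv.finiteDimensional (Submodule.equivMapOfInjective
        (⊥ : Submodule K V).mkQ ?_ H).symm)
      rw [← LinearMap.ker_eq_bot, Submodule.ker_mkQ]
    obtain ⟨F, hF, c, hc⟩ := hscalar
    refine ⟨c, LinearMap.ker (φ - c • LinearMap.id), ?_, ?_, ?_⟩
    · rintro rfl
      have hrange : (⊤ : Submodule K V) ⊓ (⊤ : Submodule K V).map φ ≤ F := by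
        rintro _ ⟨-, x, -, rfl⟩
        simpa using hc x
      have hfin := h ⊤
      have : FiniteDimensional K ↥((⊤ : Submodule K V) ⊓ (⊤ : Submodule K V).map φ) :=
        Submodule.finiteDimensional_of_le hrange
      rw [Submodule.map_top (Submodule.mkQ _), Submodule.range_mkQ] at hfin
      have := Module.Finite.equiv (Submodule.topEquiv (R := K)
        (M := V ⧸ ((⊤ : Submodule K V) ⊓ (⊤ : Submodule K V).map φ)))
      exact hV (Module.Finite.of_submodule_quotient
        ((⊤ : Submodule K V) ⊓ (⊤ : Submodule K V).map φ))
    · have : FiniteDimensional K (LinearMap.range (φ - c • LinearMap.id)) := by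
        refine Submodule.finiteDimensional_of_le (S₂ := F) ?_
        rintro _ ⟨x, rfl⟩
        exact hc x
      exact (φ - c • LinearMap.id).quotKerEquivRange.symm.finiteDimensional
    · intro x hx
      simpa [sub_eq_zero] using hx
  · rintro ⟨c, W, hc, hW, hφ⟩ H
    refine finiteDimensional_map_mkQ_of_inf_le (W := W) ?_
    rintro x ⟨hxH, hxW⟩
    refine ⟨hxH, c⁻¹ • x, H.smul_mem _ hxH, ?_⟩
    rw [map_smul, hφ x hxW, inv_smul_smul₀ hc]
end

section
/- Let K be a field, V an infinite-dimensional K-vector space and φ : V → V a K-linear endomorphism. Then every subspace H of V has finite codimension in H + φ(H) (i.e., (H + φ(H))/H is finite-dimensional for every subspace H) if and only if there exists a scalar c ∈ K such that the endomorphism x ↦ φ(x) − c·x has finite-dimensional image. (Equivalently, the ring of endomorphisms with this property is the sum of the ring of scalar multiplications and the ring of finitary endomorphisms.) -/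
/-- If `φ v ∈ K v + W` for all `v ∉ W`, where `W` is finite-dimensional in an infinite-dimensional
space, then `φ` is a scalar modulo `W`. -/
theorem LinearMap.exists_sub_smul_mem_of_forall_notMem
    {K : Type*} [Field K] {V : Type*} [AddCommGroup V] [Module K V]
    (hV : ¬ FiniteDimensional K V) (φ : V →ₗ[K] V) (W : Submodule K V) [FiniteDimensional K W]
    (h : ∀ v, v ∉ W → ∃ c : K, φ v - c • v ∈ W) :
    ∃ c : K, ∀ v, φ v - c • v ∈ W := by
  have hne (F : Submodule K V) [FiniteDimensional K F] : ∃ v, v ∉ F := by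
    by_contra! hF
    have hFtop : F = ⊤ := by ext; simp [hF]
    subst hFtop
    exact hV (Module.Finite.equiv (Submodule.topEquiv (R := K) (M := V)))
  obtain ⟨u, hu⟩ := hne W
  obtain ⟨c, hc⟩ := h u hu
  obtain ⟨t, ht⟩ := hne (W ⊔ K ∙ u)
  have key (w : V) (hw : w ∉ W ⊔ K ∙ u) : φ w - c • w ∈ W := by
    have mem_sup {x : V} (a : K) (hx : x - a • u ∈ W) : x ∈ W ⊔ K ∙ u :=
      Submodule.mem_sup.2 ⟨_, hx, a • u,
        Submodule.smul_mem _ _ (Submodule.mem_span_singleton_self u), by abel⟩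
    have hwW : w ∉ W := fun hw' ↦ hw (Submodule.mem_sup_left hw')
    obtain ⟨d, hd⟩ := h w hwW
    obtain ⟨e, he⟩ := h (u + w) fun h' ↦ hw (mem_sup (-1) (by
      convert h' using 1; module))
    have hcomb : (c - e) • u + (d - e) • w ∈ W := by
      convert W.sub_mem (W.sub_mem he hc) hd using 1
      rw [map_add]; module
    have hde : d = e := by
      by_contra hne
      have hne := sub_ne_zero.2 hne
      refine hw (mem_sup (-((d - e)⁻¹ * (c - e))) ?_)
      convert W.smul_mem (d - e)⁻¹ hcomb using 1
      rw [smul_add, smul_smul, smul_smul, inv_mul_cancel₀ hne]; module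
    have hce : c = e := by
      by_contra hne
      rw [hde, sub_self, zero_smul, add_zero] at hcomb
      exact hu ((W.smul_mem_iff (sub_ne_zero.2 hne)).1 hcomb)
    rwa [hce, ← hde]
  refine ⟨c, fun x ↦ ?_⟩
  by_cases hx : x ∈ W ⊔ K ∙ u
  · have hxt := key (x + t) fun h' ↦ ht ((Submodule.add_mem_iff_right _ hx).1 h')
    convert W.sub_mem hxt (key t ht) using 1
    rw [map_add]; module
  · exact key x hx

/-- There is a subspace maximal among those that meet their preimage under `φ` trivially. -/
theorem LinearMap.exists_maximal_disjoint_comap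
    {K : Type*} [Field K] {V : Type*} [AddCommGroup V] [Module K V] (φ : V →ₗ[K] V) :
    ∃ H : Submodule K V, Maximal (fun H : Submodule K V ↦ ∀ x ∈ H, φ x ∈ H → x = 0) H := by
  refine zorn_le₀ {H : Submodule K V | ∀ x ∈ H, φ x ∈ H → x = 0} fun C hC hchain ↦ ?_
  rcases C.eq_empty_or_nonempty with rfl | hne
  · exact ⟨⊥, fun x hx _ ↦ by simpa using hx, by simp⟩
  refine ⟨sSup C, fun x hx hφx ↦ ?_, fun _ ↦ le_sSup⟩
  rw [Submodule.mem_sSup_of_directed hne hchain.directedOn] at hx hφx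
  obtain ⟨A, hA, hxA⟩ := hx
  obtain ⟨B, hB, hxB⟩ := hφx
  obtain ⟨D, hD, hAD, hBD⟩ := hchain.directedOn A hA B hB
  exact hC hD x (hAD hxA) (hBD hxB)

/-- Let `K` be a field, `V` an infinite-dimensional `K`-vector space and
`φ : V → V` a `K`-linear endomorphism.  Every subspace `H` of `V` has finite codimension in
`H + φ(H)` if and only if there is a scalar `c ∈ K` such that `x ↦ φ x - c • x` has
finite-dimensional image; i.e. `φ` is the sum of a scalar multiplication and a finitary
endomorphism. -/
theorem inertial_linear_iff_scalar_add_finitary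
    (K : Type*) [Field K] (V : Type*) [AddCommGroup V] [Module K V]
    (hV : ¬ FiniteDimensional K V) (φ : V →ₗ[K] V) :
    (∀ H : Submodule K V,
        FiniteDimensional K ((H ⊔ H.map φ).map H.mkQ)) ↔
    (∃ c : K, FiniteDimensional K
        (LinearMap.range (φ - c • (LinearMap.id : V →ₗ[K] V)))) := by
  constructor
  · intro hfin
    obtain ⟨H, hH, hmax⟩ := φ.exists_maximal_disjoint_comap
    have := hfin H
    have : FiniteDimensional K H := by
      let g : H →ₗ[K] (H ⊔ H.map φ).map H.mkQ :=
        (H.mkQ ∘ₗ φ ∘ₗ H.subtype).codRestrict _ fun x ↦ Submodule.mem_map_of_mem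
          (Submodule.mem_sup_right (Submodule.mem_map_of_mem x.2))
      refine Module.Finite.of_injective g ((injective_iff_map_eq_zero g).2 fun x hx ↦ ?_)
      have hx' : H.mkQ (φ x) = 0 := congrArg Subtype.val hx
      rw [Submodule.mkQ_apply, Submodule.Quotient.mk_eq_zero] at hx'
      exact Subtype.ext (hH x x.2 hx')
    obtain ⟨c, hc⟩ := φ.exists_sub_smul_mem_of_forall_notMem hV (H ⊔ H.map φ) fun v hv ↦ by
      by_contra! hcon
      refine hv (Submodule.mem_sup_left (hmax (y := H ⊔ K ∙ v) ?_ le_sup_left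
        (Submodule.mem_sup_right (Submodule.mem_span_singleton_self v))))
      intro x hx hφx
      obtain ⟨y, hy, _, hz, rfl⟩ := Submodule.mem_sup.1 hx
      obtain ⟨a, rfl⟩ := Submodule.mem_span_singleton.1 hz
      obtain ⟨y', hy', _, hz', heq⟩ := Submodule.mem_sup.1 hφx
      obtain ⟨b, rfl⟩ := Submodule.mem_span_singleton.1 hz'
      rw [map_add, map_smul] at heq
      have hsub : y' - φ y ∈ H ⊔ H.map φ := Submodule.sub_mem _ (Submodule.mem_sup_left hy')
        (Submodule.mem_sup_right (Submodule.mem_map_of_mem hy))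
      have hdiff : y' - φ y = a • φ v - b • v := by
        rw [sub_eq_sub_iff_add_eq_add, heq]; abel
      rw [hdiff] at hsub
      have ha : a = 0 := by
        by_contra ha
        refine hcon (a⁻¹ * b) ?_
        convert Submodule.smul_mem _ a⁻¹ hsub using 1
        rw [smul_sub, smul_smul, smul_smul, inv_mul_cancel₀ ha, one_smul]
      subst ha
      have hb : b = 0 := by
        by_contra hb
        refine hv ((Submodule.smul_mem_iff _ (neg_ne_zero.2 hb)).1 ?_)
        convert hsub using 1; module
      subst hb
      simp only [zero_smul, add_zero] at heq ⊢
      exact hH y hy (heq ▸ hy')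
    refine ⟨c, Submodule.finiteDimensional_of_le (S₂ := H ⊔ H.map φ) ?_⟩
    rintro _ ⟨x, rfl⟩
    exact hc x
  · rintro ⟨c, hc⟩ H
    refine Submodule.finiteDimensional_of_le
      (S₂ := (LinearMap.range (φ - c • (LinearMap.id : V →ₗ[K] V))).map H.mkQ) ?_
    rw [Submodule.map_sup, Submodule.mkQ_map_self, bot_sup_eq]
    rintro _ ⟨_, ⟨x, hx, rfl⟩, rfl⟩
    refine ⟨_, ⟨x, rfl⟩, ?_⟩
    rw [← sub_eq_zero, ← map_sub, Submodule.mkQ_apply, Submodule.Quotient.mk_eq_zero]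
    convert H.smul_mem (-c) hx using 1
    simp
end

section
/- Let A be a non-periodic abelian group (A contains an element of infinite order), φ : A → A an endomorphism and m, n coprime integers with n ≥ 1. Then the following are equivalent: (MF) there exists a subgroup A₀ of finite index in A such that A₀ is uniquely p-divisible for every prime p dividing n, and n·φ(a) = m·a for all a ∈ A₀; (FM) there exists a finite subgroup A₁ of A such that A/A₁ is uniquely p-divisible for every prime p dividing n, and n·φ(a) − m·a ∈ A₁ for all a ∈ A. -/
/-- Multiplication by `n ≠ 0` is bijective iff multiplication by each prime factor of `n` is. -/
theorem forall_prime_bijective_nsmul_iff_bijective_zsmul {B : Type*} [AddCommGroup B] {n : ℤ}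
    (hn : n ≠ 0) :
    (∀ p : ℕ, p.Prime → (p : ℤ) ∣ n → Function.Bijective (fun x : B => p • x)) ↔
      Function.Bijective (fun x : B => n • x) := by
  constructor
  · intro h
    have key : ∀ d : ℕ, d ≠ 0 → (d : ℤ) ∣ n → Function.Bijective (fun x : B => d • x) := by
      intro d
      induction d using induction_on_primes with
      | zero => exact fun h0 => absurd rfl h0
      | one => simpa using! Function.bijective_id
      | prime_mul p a hp ih =>
        intro hpa hd
        push_cast at hd
        have hc := (h p hp (dvd_of_mul_right_dvd hd)).comp
          (ih (right_ne_zero_of_mul hpa) (dvd_of_mul_left_dvd hd))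
        simpa only [Function.comp_def, ← mul_nsmul'] using hc
    have hb := key n.natAbs (Int.natAbs_ne_zero.mpr hn) Int.natAbs_dvd_self
    rcases Int.natAbs_eq n with h' | h'
    · rw [h']
      simpa only [natCast_zsmul] using hb
    · rw [h']
      simpa only [Function.comp_def, neg_smul, natCast_zsmul, Equiv.neg_apply] using
        (Equiv.neg B).bijective.comp hb
  · rintro h p - ⟨q, rfl⟩
    refine ⟨fun x y hxy => h.1 ?_, fun y => ?_⟩
    · simp only [mul_comm (p : ℤ) q, mul_smul, natCast_zsmul] at hxy ⊢
      rw [hxy]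
    · obtain ⟨x, hx⟩ := h.2 y
      exact ⟨q • x, by simpa only [mul_smul, natCast_zsmul] using hx⟩

theorem bijective_pow_zsmul {B : Type*} [AddCommGroup B] {n : ℤ}
    (h : Function.Bijective (fun x : B => n • x)) (k : ℕ) :
    Function.Bijective (fun x : B => n ^ k • x) := by
  induction k with
  | zero => simpa using! Function.bijective_id
  | succ k ih => simpa only [Function.comp_def, pow_succ, mul_smul] using ih.comp h

/-- Modulo `N ≠ 0`, the ideals generated by the powers of `n` stabilize. -/
theorem exists_pow_eq_mul_add_mul_pow_succ (n : ℤ) {N : ℕ} (hN : N ≠ 0) :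
    ∃ (k : ℕ) (c d : ℤ), n ^ k = c * N + d * n ^ (k + 1) := by
  have : NeZero N := ⟨hN⟩
  obtain ⟨i, j, hij, h⟩ : ∃ i j : ℕ, i < j ∧ (n : ZMod N) ^ i = (n : ZMod N) ^ j := by
    obtain ⟨i, j, hne, h⟩ :=
      Finite.exists_ne_map_eq_of_infinite (fun i : ℕ => (n : ZMod N) ^ i)
    rcases lt_or_gt_of_ne hne with hlt | hlt
    exacts [⟨i, j, hlt, h⟩, ⟨j, i, hlt, h.symm⟩]
  obtain ⟨l, rfl⟩ := Nat.exists_eq_add_of_lt hij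
  have hdvd : (N : ℤ) ∣ n ^ i - n ^ (i + l + 1) := by
    rw [← ZMod.intCast_zmod_eq_zero_iff_dvd]
    push_cast
    rw [h, sub_self]
  obtain ⟨c, hc⟩ := hdvd
  exact ⟨i, c, n ^ l, by linear_combination hc⟩

/-- If multiplication by `n` is bijective on a finite-index subgroup contained in the kernel of
an endomorphism `f`, then it is bijective modulo some finite subgroup containing the range
of `f`. -/
theorem exists_finite_bijective_zsmul_quotient {A : Type*} [AddCommGroup A] {n : ℤ}
    {f : A →+ A} {A₀ : AddSubgroup A} (hi : A₀.index ≠ 0)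
    (hb : Function.Bijective (fun x : A₀ => n • x)) (hf : A₀ ≤ f.ker) :
    ∃ A₁ : AddSubgroup A, (A₁ : Set A).Finite ∧
      Function.Bijective (fun x : A ⧸ A₁ => n • x) ∧ ∀ a, f a ∈ A₁ := by
  obtain ⟨k, c, d, hk⟩ := exists_pow_eq_mul_add_mul_pow_succ n hi
  have hinj : ∀ (j : ℕ) (x : A), x ∈ A₀ → n ^ j • x = 0 → x = 0 := fun j x hx h => by
    have := @(bijective_pow_zsmul hb j).1 ⟨x, hx⟩ 0 (Subtype.ext (by simpa using h))
    simpa using congrArg Subtype.val this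
  have hmem : ∀ a : A, (c * (A₀.index : ℤ)) • a ∈ A₀ := fun a => by
    rw [mul_smul, natCast_zsmul]
    exact A₀.zsmul_mem (A₀.nsmul_index_mem a) c
  have htors : ∀ x : A, n ^ (k + 1) • x = 0 → n ^ k • x = 0 := fun x hx => by
    have hx' : n ^ k • x = (c * (A₀.index : ℤ)) • x := by
      rw [hk, add_smul, mul_smul d, hx, smul_zero, add_zero]
    refine hinj 1 _ (hx' ▸ hmem x) ?_
    rwa [pow_one, ← mul_smul, ← pow_succ']
  have hdiv : ∀ x : A, ∃ y, n ^ k • x = n ^ (k + 1) • y := fun x => by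
    obtain ⟨y, hy⟩ := (bijective_pow_zsmul hb (k + 1)).2 ⟨_, hmem x⟩
    refine ⟨y + d • x, ?_⟩
    have hy' : n ^ (k + 1) • (y : A) = (c * (A₀.index : ℤ)) • x := by
      simpa using congrArg Subtype.val hy
    rw [smul_add, hy', smul_smul, mul_comm _ d, ← add_smul, ← hk]
  let T : AddSubgroup A := (zsmulAddGroupHom (n ^ k) : A →+ A).ker
  have hT : ∀ x, x ∈ T ↔ n ^ k • x = 0 := fun x => Iff.rfl
  have hTfin : (T : Set A).Finite := by
    have : A₀.FiniteIndex := ⟨hi⟩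
    refine Finite.of_injective (fun t : T => ((t : A) : A ⧸ A₀)) fun s t hst => ?_
    have hst' : -(s : A) + t ∈ A₀ := QuotientAddGroup.eq.1 hst
    have h0 := hinj k _ hst' ((hT _).1 (T.add_mem (T.neg_mem s.2) t.2))
    exact Subtype.ext (neg_add_eq_zero.1 h0)
  have hFfin : (f.range : Set A).Finite := by
    refine Nat.finite_of_card_ne_zero (α := f.range) ?_
    rw [← AddSubgroup.index_ker]
    exact ne_zero_of_dvd_ne_zero hi (AddSubgroup.index_dvd_of_le hf)
  refine ⟨T ⊔ f.range, ?_, ⟨?_, ?_⟩, fun a => AddSubgroup.mem_sup_right ⟨a, rfl⟩⟩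
  · rw [AddSubgroup.add_normal]
    exact hTfin.add hFfin
  · refine (injective_iff_map_eq_zero (zsmulAddGroupHom n : A ⧸ (T ⊔ f.range) →+ _)).2 ?_
    intro q
    induction q using QuotientAddGroup.induction_on with
    | H a =>
      intro ha
      have ha' : n • a ∈ T ⊔ f.range := (QuotientAddGroup.eq_zero_iff _).1 ha
      obtain ⟨t, ht, _, ⟨b, rfl⟩, hab⟩ := AddSubgroup.mem_sup.1 ha'
      obtain ⟨e, he⟩ := hdiv b
      refine (QuotientAddGroup.eq_zero_iff _).2
        (AddSubgroup.mem_sup.2 ⟨a - f e, (hT _).2 (htors _ ?_), f e, ⟨e, rfl⟩, by abel⟩)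
      rw [smul_sub, ← map_zsmul, ← he, map_zsmul, pow_succ, mul_smul, ← hab, smul_add,
        (hT t).1 ht, zero_add, sub_self]
  · intro q
    induction q using QuotientAddGroup.induction_on with
    | H a =>
      obtain ⟨b, hb⟩ := hdiv a
      refine ⟨(b : A ⧸ (T ⊔ f.range)), ?_⟩
      refine QuotientAddGroup.eq.2 (AddSubgroup.mem_sup_left ((hT _).2 ?_))
      rw [smul_add, smul_neg, smul_smul, ← pow_succ, ← hb, neg_add_cancel]

/-- If multiplication by `n` is bijective modulo a finite subgroup containing the range of an
endomorphism `f`, then it is bijective on some finite-index subgroup contained in the kernel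
of `f`. -/
theorem exists_index_ne_zero_bijective_zsmul {A : Type*} [AddCommGroup A] {n : ℤ}
    {f : A →+ A} {A₁ : AddSubgroup A} (hfin : (A₁ : Set A).Finite)
    (hb : Function.Bijective (fun x : A ⧸ A₁ => n • x)) (hf : ∀ a, f a ∈ A₁) :
    ∃ A₀ : AddSubgroup A, A₀.index ≠ 0 ∧
      Function.Bijective (fun x : A₀ => n • x) ∧ A₀ ≤ f.ker := by
  have : Finite A₁ := hfin
  obtain ⟨k, c, d, hk⟩ := exists_pow_eq_mul_add_mul_pow_succ n (Nat.card_pos (α := A₁)).ne'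
  have hkA₁ : ∀ t ∈ A₁, n ^ k • t = n ^ (k + 1) • d • t := fun t ht => by
    have h0 : Nat.card A₁ • t = 0 := congrArg Subtype.val (card_nsmul_eq_zero' (x := (⟨t, ht⟩ : A₁)))
    rw [smul_smul, mul_comm _ d]
    conv_lhs => rw [hk, add_smul, mul_smul c, natCast_zsmul, h0, smul_zero, zero_add]
  have htors : ∀ x : A, n ^ (k + 1) • x = 0 → n ^ k • x = 0 := fun x hx => by
    have hxA₁ : x ∈ A₁ := by
      rw [← QuotientAddGroup.eq_zero_iff]
      refine (bijective_pow_zsmul hb (k + 1)).1 ?_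
      simp only [smul_zero]
      rw [← QuotientAddGroup.mk_zsmul, hx, QuotientAddGroup.mk_zero]
    rw [hkA₁ x hxA₁, smul_comm, hx, smul_zero]
  have hdec : ∀ (j : ℕ) (x : A), ∃ y, ∃ t ∈ A₁, x = n ^ j • y + t := fun j x => by
    obtain ⟨q, hq⟩ := (bijective_pow_zsmul hb j).2 (x : A ⧸ A₁)
    induction q using QuotientAddGroup.induction_on with
    | H y => exact ⟨y, _, QuotientAddGroup.eq.1 hq, (add_neg_cancel_left _ _).symm⟩
  have hdiv : ∀ x : A, ∃ y, n ^ k • x = n ^ (k + 1) • y := fun x => by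
    obtain ⟨y, t, ht, rfl⟩ := hdec 1 x
    exact ⟨y + d • t, by rw [smul_add, smul_add, hkA₁ t ht, pow_one, smul_smul, pow_succ]⟩
  let D : AddSubgroup A := (zsmulAddGroupHom (n ^ k) : A →+ A).range
  have hD : D.index ≠ 0 := by
    have : Finite (A ⧸ D) := by
      refine Finite.of_surjective (fun t : A₁ => ((t : A) : A ⧸ D)) fun q => ?_
      induction q using QuotientAddGroup.induction_on with
      | H x =>
        obtain ⟨y, t, ht, rfl⟩ := hdec k x
        exact ⟨⟨t, ht⟩, QuotientAddGroup.eq.2 ⟨y, by simp⟩⟩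
    exact AddSubgroup.index_ne_zero_of_finite
  have hK : f.ker.index ≠ 0 := by
    have : Finite f.range := hfin.subset (by rintro _ ⟨a, rfl⟩; exact hf a)
    rw [AddSubgroup.index_ker]
    exact Nat.card_pos.ne'
  refine ⟨D ⊓ f.ker, AddSubgroup.index_inf_ne_zero hD hK, ⟨?_, ?_⟩, inf_le_right⟩
  · refine (injective_iff_map_eq_zero (zsmulAddGroupHom n : (D ⊓ f.ker : AddSubgroup A) →+ _)).2 ?_
    rintro ⟨_, ⟨a, rfl⟩, ha⟩ h
    refine Subtype.ext (htors a ?_)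
    rw [pow_succ', mul_smul]
    exact congrArg Subtype.val h
  · rintro ⟨_, ⟨a, rfl⟩, ha⟩
    obtain ⟨b, hb⟩ := hdiv a
    have ha' : f (n ^ k • a) = 0 := ha
    refine ⟨⟨n ^ k • b, ⟨b, rfl⟩, ?_⟩, Subtype.ext ?_⟩
    · change f (n ^ k • b) = 0
      rw [map_zsmul]
      exact htors _ (by rw [← map_zsmul, ← hb, ha'])
    · change n • n ^ k • b = n ^ k • a
      rw [hb, pow_succ', mul_smul]


/-- Let `A` be a non-periodic abelian group, `φ : A → A` an endomorphism and
`m, n` coprime integers with `n ≥ 1`.  Then `φ` acts as multiplication by `m/n` on a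
finite-index subgroup of `A` (condition MF) if and only if it does so modulo a finite
subgroup of `A` (condition FM). -/
theorem multiplication_on_finite_index_iff_multiplication_mod_finite
    {A : Type*} [AddCommGroup A] (hA : ∃ a : A, addOrderOf a = 0)
    (φ : A →+ A) (m n : ℤ) (hn : 1 ≤ n) (hmn : IsCoprime m n) :
    (∃ A₀ : AddSubgroup A, A₀.index ≠ 0 ∧
        (∀ p : ℕ, p.Prime → (p : ℤ) ∣ n →
          Function.Bijective (fun x : A₀ => p • x)) ∧
        ∀ a ∈ A₀, n • φ a = m • a) ↔
    (∃ A₁ : AddSubgroup A, (A₁ : Set A).Finite ∧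
        (∀ p : ℕ, p.Prime → (p : ℤ) ∣ n →
          Function.Bijective (fun x : A ⧸ A₁ => p • x)) ∧
        ∀ a : A, n • φ a - m • a ∈ A₁) := by
  have hn0 : n ≠ 0 := by lia
  let f : A →+ A := n • φ - m • AddMonoidHom.id A
  simp only [forall_prime_bijective_nsmul_iff_bijective_zsmul hn0]
  constructor
  · rintro ⟨A₀, hi, hb, h⟩
    exact exists_finite_bijective_zsmul_quotient (f := f) hi hb
      fun a ha => sub_eq_zero.2 (h a ha)
  · rintro ⟨A₁, hfin, hb, h⟩
    obtain ⟨A₀, hi, hb₀, hle⟩ := exists_index_ne_zero_bijective_zsmul (f := f) hfin hb h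
    exact ⟨A₀, hi, hb₀, fun a ha => sub_eq_zero.1 (hle ha)⟩
end

section
/- Let p be a prime and A an unbounded abelian p-group. Let φ : A → A be an endomorphism such that for every a ∈ A there is an integer m (depending on a) with φ(a) = m·a. If the image of φ is a finite set, then φ = 0. -/
/-- An annihilating integer is divisible by the exact prime-power order. -/
lemma pow_succ_dvd_of_zsmul_eq_zero {A : Type*} [AddCommGroup A] {p f : ℕ} (hp : p.Prime)
    {b : A} (hb : p ^ f • b ≠ 0) (hb' : p ^ (f + 1) • b = 0) {z : ℤ} (hz : z • b = 0) :
    (p : ℤ) ^ (f + 1) ∣ z := by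
  have := Fact.mk hp
  have h := addOrderOf_eq_prime_pow hb hb'
  have h2 := addOrderOf_dvd_iff_zsmul_eq_zero.mpr hz
  rw [h] at h2
  exact_mod_cast h2

/-- A multiplication whose image is killed by `p ^ k` acts on an element of order `p ^ (f + 1)`
as a multiple of `p ^ e`, whenever `e + k ≤ f + 1`. -/
lemma exists_zsmul_pow_of_pow_smul_eq_zero {A : Type*} [AddCommGroup A] {p f k e : ℕ}
    (hp : p.Prime) {φ : A →+ A} (hmul : ∀ a : A, ∃ m : ℤ, φ a = m • a)
    (hk : ∀ a : A, p ^ k • φ a = 0) (hf : e + k ≤ f + 1) {b : A} (hb : p ^ f • b ≠ 0)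
    (hb' : p ^ (f + 1) • b = 0) : ∃ t : ℤ, φ b = (t * (p : ℤ) ^ e) • b := by
  obtain ⟨m, hm⟩ := hmul b
  have h1 : ((p : ℤ) ^ k * m) • b = 0 := by
    rw [mul_smul, ← hm]
    exact_mod_cast hk b
  have h2 := pow_succ_dvd_of_zsmul_eq_zero hp hb hb' h1
  have h3 : (p : ℤ) ^ k * (p : ℤ) ^ e ∣ (p : ℤ) ^ k * m := by
    rw [← pow_add]
    exact (pow_dvd_pow _ (by omega)).trans h2
  have hp0 : (p : ℤ) ^ k ≠ 0 := pow_ne_zero _ (by exact_mod_cast hp.ne_zero)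
  obtain ⟨t, rfl⟩ := (mul_dvd_mul_iff_left hp0).mp h3
  exact ⟨t, by rw [hm, mul_comm]⟩

/-- In an unbounded `p`-group there are elements of arbitrarily large exact order. -/
lemma exists_pow_smul_ne_zero_of_unbounded {A : Type*} [AddCommGroup A] {p : ℕ} (hp : p.Prime)
    (hpgroup : ∀ a : A, ∃ k : ℕ, p ^ k • a = 0)
    (hunbounded : ¬ ∃ n : ℕ, 0 < n ∧ ∀ a : A, n • a = 0) (N : ℕ) :
    ∃ (b : A) (f : ℕ), N ≤ f ∧ p ^ f • b ≠ 0 ∧ p ^ (f + 1) • b = 0 := by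
  classical
  obtain ⟨b, hb⟩ : ∃ b : A, p ^ N • b ≠ 0 := by
    by_contra! h
    exact hunbounded ⟨p ^ N, pow_pos hp.pos _, h⟩
  have hlt : N < Nat.find (hpgroup b) := by
    rw [Nat.lt_find_iff]
    intro j hj h0
    apply hb
    rw [← Nat.sub_add_cancel hj, pow_add, mul_smul, h0, smul_zero]
  obtain ⟨f, hf⟩ := Nat.exists_eq_succ_of_ne_zero (Nat.ne_zero_of_lt hlt)
  refine ⟨b, f, by omega, Nat.find_min (hpgroup b) (by omega), ?_⟩
  have := Nat.find_spec (hpgroup b)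
  rwa [hf] at this

/-- A finite image in a `p`-group is killed by a single power of `p`. -/
lemma exists_pow_smul_eq_zero_of_finite_range {A : Type*} [AddCommGroup A] {p : ℕ}
    (hpgroup : ∀ a : A, ∃ k : ℕ, p ^ k • a = 0) {φ : A →+ A} (hfin : (Set.range φ).Finite) :
    ∃ k : ℕ, ∀ a : A, p ^ k • φ a = 0 := by
  choose κ hκ using hpgroup
  obtain ⟨k, hk⟩ := (hfin.image κ).bddAbove
  refine ⟨k, fun a => ?_⟩
  have h : κ (φ a) ≤ k := hk ⟨φ a, ⟨a, rfl⟩, rfl⟩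
  rw [← Nat.sub_add_cancel h, pow_add, mul_smul, hκ, smul_zero]

/-- Let `p` be a prime and `A` an unbounded abelian `p`-group.  If
`φ : A → A` is an endomorphism acting as a multiplication (for every `a` there is an
integer `m` with `φ a = m • a`) and the image of `φ` is finite, then `φ = 0`. -/
theorem multiplication_eq_zero_of_finite_image_of_unbounded
    {A : Type*} [AddCommGroup A] (p : ℕ) (hp : p.Prime)
    (hpgroup : ∀ a : A, ∃ k : ℕ, p ^ k • a = 0)
    (hunbounded : ¬ ∃ n : ℕ, 0 < n ∧ ∀ a : A, n • a = 0)
    (φ : A →+ A) (hmul : ∀ a : A, ∃ m : ℤ, φ a = m • a)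
    (hfin : (Set.range φ).Finite) :
    φ = 0 := by
  obtain ⟨k, hk⟩ := exists_pow_smul_eq_zero_of_finite_range hpgroup hfin
  suffices h : ∀ (e : ℕ) (a : A), p ^ e • a = 0 → φ a = 0 by
    ext a
    obtain ⟨e, he⟩ := hpgroup a
    exact h e a he
  intro e
  induction e with
  | zero =>
    intro a ha
    simp only [pow_zero, one_smul] at ha
    simp [ha]
  | succ e ih =>
    intro a ha
    by_cases ha0 : p ^ e • a = 0
    · exact ih a ha0
    obtain ⟨b, f, hf, hb, hb'⟩ :=
      exists_pow_smul_ne_zero_of_unbounded hp hpgroup hunbounded (e + 1 + k)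
    have kill : ∀ j, e + 1 ≤ j → p ^ j • a = 0 := fun j hj => by
      rw [← Nat.sub_add_cancel hj, pow_add, mul_smul, ha, smul_zero]
    obtain ⟨t, ht⟩ := exists_zsmul_pow_of_pow_smul_eq_zero (e := e + 1) (f := f) hp hmul
      hk (by omega) hb hb'
    obtain ⟨s, hs⟩ := exists_zsmul_pow_of_pow_smul_eq_zero (e := e + 1) (f := f) (b := a + b)
      hp hmul hk
      (by omega) (by rwa [smul_add, kill f (by omega), zero_add])
      (by rw [smul_add, kill (f + 1) (by omega), hb', zero_add])
    have haz : (p : ℤ) ^ (e + 1) • a = 0 := by exact_mod_cast ha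
    have hab : φ a = (s * (p : ℤ) ^ (e + 1) - t * (p : ℤ) ^ (e + 1)) • b := by
      rw [map_add, ht, smul_add, mul_smul s _ a, haz, smul_zero, zero_add] at hs
      rw [sub_smul, ← hs, add_sub_cancel_right]
    have hpa : (p : ℤ) • φ a = 0 := by
      have h := ih (p • a) (by rw [← mul_smul, ← pow_succ, ha])
      rw [map_nsmul] at h
      exact_mod_cast h
    have hp0 : (p : ℤ) ≠ 0 := by exact_mod_cast hp.ne_zero
    obtain ⟨v, hv⟩ : ∃ v : ℤ, φ a = (v * (p : ℤ) ^ f) • b := by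
      have h := hpa
      rw [hab, ← mul_smul] at h
      have h2 := pow_succ_dvd_of_zsmul_eq_zero hp hb hb' h
      rw [pow_succ', mul_dvd_mul_iff_left hp0] at h2
      obtain ⟨v, hv⟩ := h2
      exact ⟨v, by rw [hab, hv, mul_comm]⟩
    obtain ⟨n, hn⟩ : ∃ n : ℤ, φ a = (n * (p : ℤ) ^ e) • a := by
      obtain ⟨n, hn⟩ := hmul a
      rw [hn, ← mul_smul] at hpa
      have h2 := pow_succ_dvd_of_zsmul_eq_zero hp ha0 ha hpa
      rw [pow_succ', mul_dvd_mul_iff_left hp0] at h2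
      obtain ⟨v, rfl⟩ := h2
      exact ⟨v, by rw [hn, mul_comm]⟩
    by_cases hpn : (p : ℤ) ∣ n
    · obtain ⟨q, rfl⟩ := hpn
      rw [hn, show (p : ℤ) * q * (p : ℤ) ^ e = q * (p : ℤ) ^ (e + 1) by ring, mul_smul, haz,
        smul_zero]
    obtain ⟨y, x, hxy⟩ := (Nat.prime_iff_prime_int.mp hp).coprime_iff_not_dvd.mpr hpn
    have hpe : (p : ℤ) ^ e • a = (x * v * (p : ℤ) ^ f) • b := by
      calc (p : ℤ) ^ e • a = (y * p + x * n) • (p : ℤ) ^ e • a := by rw [hxy, one_smul]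
        _ = y • (p : ℤ) ^ (e + 1) • a + x • (n * (p : ℤ) ^ e) • a := by
          simp only [← mul_smul, ← add_smul]
          ring_nf
        _ = (x * v * (p : ℤ) ^ f) • b := by
          rw [haz, smul_zero, zero_add, ← hn, hv, ← mul_smul, mul_assoc]
    have hdiff : φ (a - (x * v * (p : ℤ) ^ (f - e)) • b) = 0 := by
      apply ih
      have h : (p : ℤ) ^ e • (a - (x * v * (p : ℤ) ^ (f - e)) • b) = 0 := by
        rw [smul_sub, hpe, ← mul_smul, ← sub_smul,
          show (p : ℤ) ^ f = (p : ℤ) ^ e * (p : ℤ) ^ (f - e) by rw [← pow_add]; congr 1; omega]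
        ring_nf
        simp
      exact_mod_cast h
    rw [map_sub, map_zsmul, sub_eq_zero] at hdiff
    have hkb : (p : ℤ) ^ (f - e) • φ b = 0 := by
      have h : (p : ℤ) ^ k • φ b = 0 := by exact_mod_cast hk b
      rw [← Nat.sub_add_cancel (show k ≤ f - e by omega), pow_add, mul_smul, h, smul_zero]
    rw [hdiff, mul_smul, hkb, smul_zero]
end

section
/- Let p be a prime, A an abelian p-group, and φ : A → A an endomorphism such that for every a ∈ A there is an integer m (depending on a) with φ(a) = m·a. If the image φ(A) is bounded and φ ≠ 0, then A is bounded. -/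
/-- An element of a `p`-group killed by an integer prime to `p` is zero. -/
lemma eq_zero_of_zsmul_eq_zero_of_not_dvd {A : Type*} [AddCommGroup A] {p : ℕ} (hp : p.Prime)
    {x : A} {e : ℕ} {u : ℤ} (he : (p : ℤ) ^ e • x = 0) (hu : u • x = 0) (hpu : ¬ (p : ℤ) ∣ u) :
    x = 0 := by
  have hcop : IsCoprime ((p : ℤ) ^ e) u :=
    ((Nat.prime_iff_prime_int.mp hp).coprime_iff_not_dvd.mpr hpu).pow_left
  obtain ⟨r, s, hrs⟩ := hcop
  rw [← one_smul ℤ x, ← hrs, add_smul, mul_smul, mul_smul, he, hu, smul_zero, smul_zero, add_zero]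

/-- If `p ^ (k + j)` does not kill `a` but `p ^ k * x` does, then `p ^ j` divides `x`. -/
lemma pow_dvd_of_pow_smul_ne_zero {A : Type*} [AddCommGroup A] {p : ℕ} (hp : p.Prime)
    {a : A} {k j : ℕ} {x : ℤ} (ha : ∃ e : ℕ, p ^ e • a = 0) (hne : (p : ℤ) ^ (k + j) • a ≠ 0)
    (hx : (p : ℤ) ^ k • x • a = 0) : (p : ℤ) ^ j ∣ x := by
  obtain ⟨e, he⟩ := ha
  obtain ⟨N, -, hN⟩ := (Nat.dvd_prime_pow hp).mp (addOrderOf_dvd_of_nsmul_eq_zero he)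
  rw [← mul_smul, ← addOrderOf_dvd_iff_zsmul_eq_zero, hN] at hx
  have hlt : k + j ≤ N := by
    by_contra! h
    apply hne
    rw [← addOrderOf_dvd_iff_zsmul_eq_zero, hN]
    exact_mod_cast pow_dvd_pow p h.le
  have hdvd : (p : ℤ) ^ k * (p : ℤ) ^ j ∣ (p : ℤ) ^ k * x := by
    rw [← pow_add]
    push_cast at hx
    exact (pow_dvd_pow _ hlt).trans hx
  exact (mul_dvd_mul_iff_left (pow_ne_zero _ (by exact_mod_cast hp.ne_zero))).mp hdvd

/-- A multiplication of an unbounded `p`-group whose image is killed by `p ^ k` is zero. -/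
lemma multiplication_eq_zero_of_unbounded {A : Type*} [AddCommGroup A] {p : ℕ} (hp : p.Prime)
    (hpgroup : ∀ a : A, ∃ k : ℕ, p ^ k • a = 0)
    (φ : A →+ A) (hmul : ∀ a : A, ∃ m : ℤ, φ a = m • a)
    {k : ℕ} (hk : ∀ a, (p : ℤ) ^ k • φ a = 0)
    (hunb : ∀ M : ℕ, ∃ a : A, (p : ℤ) ^ M • a ≠ 0) (s : ℕ) :
    ∀ b : A, (p : ℤ) ^ s • b = 0 → φ b = 0 := by
  induction s using Nat.strong_induction_on with
  | _ s ih =>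
  intro b hb
  obtain ⟨n, hn⟩ := hmul b
  rcases eq_or_ne n 0 with rfl | hn0
  · rw [hn, zero_smul]
  have hfin : FiniteMultiplicity (p : ℤ) n :=
    Int.finiteMultiplicity_iff.mpr ⟨by simpa using hp.ne_one, hn0⟩
  obtain ⟨u, hu, hpu⟩ := hfin.exists_eq_pow_mul_and_not_dvd
  generalize multiplicity (p : ℤ) n = t at hu
  have kill {r : ℕ} {x : ℤ} (hr : s ≤ r) (h : (p : ℤ) ^ r ∣ x) : x • b = 0 := by
    obtain ⟨y, rfl⟩ := (pow_dvd_pow (p : ℤ) hr).trans h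
    rw [mul_comm, mul_smul, hb, smul_zero]
  rcases le_or_gt s t with hst | hts
  · rw [hn]
    exact kill hst ⟨u, hu⟩
  obtain ⟨a, ha⟩ := hunb (k + 2 * s)
  obtain ⟨m, hm⟩ := hmul a
  obtain ⟨m', hm'⟩ := hmul (a + b)
  have hm'dvd : (p : ℤ) ^ (2 * s) ∣ m' := by
    refine pow_dvd_of_pow_smul_ne_zero (a := a + b) (k := k) hp (hpgroup _) ?_ (hm' ▸ hk _)
    rwa [smul_add, kill (r := k + 2 * s) (by omega) dvd_rfl, add_zero]
  have hφb : φ b = (m' - m) • a := by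
    rw [map_add, smul_add, kill (by omega) hm'dvd, add_zero, hm] at hm'
    rw [sub_smul, ← hm', add_sub_cancel_left]
  have hcdvd : (p : ℤ) ^ (k + s) ∣ m' - m := by
    refine pow_dvd_of_pow_smul_ne_zero (a := a) (k := s) hp (hpgroup _) ?_ ?_
    · rwa [show s + (k + s) = k + 2 * s by ring]
    · rw [← hφb, ← map_zsmul, hb, map_zero]
  obtain ⟨c, hc⟩ := hcdvd
  have hd : φ (u • b - ((p : ℤ) ^ (k + s - t) * c) • a) = 0 := by
    refine ih t hts _ ?_
    rw [smul_sub, ← mul_smul, ← mul_smul, ← hu, ← hn, hφb, hc, ← mul_assoc, ← pow_add,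
      Nat.add_sub_cancel' (by omega), sub_self]
  have hφa : φ (((p : ℤ) ^ (k + s - t) * c) • a) = 0 := by
    rw [show k + s - t = (s - t) + k by omega, pow_add,
      show (p : ℤ) ^ (s - t) * (p : ℤ) ^ k * c = ((p : ℤ) ^ (s - t) * c) * (p : ℤ) ^ k by ring,
      mul_smul, map_zsmul, map_zsmul, hk, smul_zero]
  rw [map_sub, hφa, sub_zero, map_zsmul] at hd
  exact eq_zero_of_zsmul_eq_zero_of_not_dvd hp (hk b) hd hpu

/-- Let `p` be a prime, `A` an abelian `p`-group, and `φ : A → A` an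
endomorphism acting as a multiplication (for every `a` there is an integer `m` with
`φ a = m • a`).  If the image `φ(A)` is bounded and `φ ≠ 0`, then `A` is bounded. -/
theorem bounded_of_multiplication_bounded_image_ne_zero
    {A : Type*} [AddCommGroup A] (p : ℕ) (hp : p.Prime)
    (hpgroup : ∀ a : A, ∃ k : ℕ, p ^ k • a = 0)
    (φ : A →+ A) (hmul : ∀ a : A, ∃ m : ℤ, φ a = m • a)
    (hbdd : ∃ n : ℕ, 0 < n ∧ ∀ a : A, n • φ a = 0)
    (hne : φ ≠ 0) :
    ∃ n : ℕ, 0 < n ∧ ∀ a : A, n • a = 0 := by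
  obtain ⟨n, hn, hnφ⟩ := hbdd
  obtain ⟨k, u, hpu, rfl⟩ := Nat.exists_eq_pow_mul_and_not_dvd hn.ne' p hp.ne_one
  have hk (a : A) : (p : ℤ) ^ k • φ a = 0 := by
    obtain ⟨e, he⟩ := hpgroup a
    have he' : (p : ℤ) ^ e • a = 0 := by exact_mod_cast he
    refine eq_zero_of_zsmul_eq_zero_of_not_dvd (e := e) (u := u) hp ?_ ?_ (by exact_mod_cast hpu)
    · rw [smul_comm, ← map_zsmul, he', map_zero, smul_zero]
    · rw [← mul_smul, mul_comm]
      exact_mod_cast hnφ a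
  by_contra! hunb
  refine hne (AddMonoidHom.ext fun b => ?_)
  obtain ⟨s, hs⟩ := hpgroup b
  refine multiplication_eq_zero_of_unbounded hp hpgroup φ hmul hk (fun M => ?_) s b
    (by exact_mod_cast hs)
  obtain ⟨a, ha⟩ := hunb (p ^ M) (pow_pos hp.pos M)
  exact ⟨a, by exact_mod_cast ha⟩
end

section
/- Let A be an abelian group, π a finite set of primes, m an integer, and A₀ a subgroup of finite index in A with an internal direct decomposition A₀ = B₀ ⊕ C₀, where B₀ is a bounded π-group and, for each p ∈ π, the p-primary component of C₀ is p-divisible with finite p-socle. Let φ : A → A be an endomorphism with φ(b) = m·b for all b ∈ B₀ and φ(c) = 0 for all c ∈ C₀. Then there exist subgroups B, C of A with A = B ⊕ C (internal direct sum), B a bounded π-group and, for each p ∈ π, the p-primary component of C p-divisible with finite p-socle, such that the endomorphism μ of A defined by μ(b + c) = m·b (for b ∈ B, c ∈ C) satisfies: the image of φ − μ is a finite set. -/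
/-- `B` is a bounded `π`-group: it is annihilated by a positive integer all of whose prime
factors lie in the finite set of primes `π`. -/
def IsBoundedPiGroup {A : Type*} [AddCommGroup A] (π : Finset ℕ) (B : AddSubgroup A) : Prop :=
  ∃ n : ℕ, 0 < n ∧ (∀ p : ℕ, p.Prime → p ∣ n → p ∈ π) ∧ ∀ b ∈ B, n • b = 0

/-- The `p`-primary component of a subgroup `C`: its elements of `p`-power order. -/
def pPrimary {A : Type*} [AddCommGroup A] (C : AddSubgroup A) (p : ℕ) : Set A :=
  {x | x ∈ C ∧ ∃ k : ℕ, p ^ k • x = 0}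

/-- The `p`-primary component of `C` is `p`-divisible with finite `p`-socle. -/
def PDivisibleFiniteSocle {A : Type*} [AddCommGroup A] (C : AddSubgroup A) (p : ℕ) : Prop :=
  (∀ x ∈ pPrimary C p, ∃ y ∈ pPrimary C p, p • y = x) ∧
    {x ∈ pPrimary C p | p • x = 0}.Finite

/-- The `π`-torsion subgroup: the elements annihilated by a positive integer whose prime factors
all lie in `π`. -/
def piTorsion (A : Type*) [AddCommGroup A] (π : Finset ℕ) : AddSubgroup A where
  carrier := {x | ∃ n ∈ Nat.factoredNumbers π, n • x = 0}
  zero_mem' := ⟨1, by simp [Nat.mem_factoredNumbers], smul_zero _⟩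
  add_mem' := by
    rintro x y ⟨n, hn, hx⟩ ⟨k, hk, hy⟩
    refine ⟨n * k, Nat.mul_mem_factoredNumbers hn hk, ?_⟩
    rw [smul_add, mul_comm, mul_smul, hx, mul_comm, mul_smul, hy, smul_zero, smul_zero, add_zero]
  neg_mem' := by
    rintro x ⟨n, hn, hx⟩
    exact ⟨n, hn, by rw [smul_neg, hx, neg_zero]⟩

theorem mem_piTorsion {A : Type*} [AddCommGroup A] {π : Finset ℕ} {x : A} :
    x ∈ piTorsion A π ↔ ∃ n ∈ Nat.factoredNumbers π, n • x = 0 := Iff.rfl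

theorem mem_piTorsion_of_prime_pow_smul_eq_zero {A : Type*} [AddCommGroup A] {π : Finset ℕ}
    {p k : ℕ} (hp : p.Prime) (hpπ : p ∈ π) {x : A} (hx : p ^ k • x = 0) : x ∈ piTorsion A π :=
  ⟨p ^ k, Nat.mem_factoredNumbers'.2 fun q hq hqp => by
    rwa [(Nat.prime_dvd_prime_iff_eq hq hp).1 (hq.dvd_of_dvd_pow hqp)], hx⟩

theorem isBoundedPiGroup_iff {A : Type*} [AddCommGroup A] {π : Finset ℕ} {B : AddSubgroup A} :
    IsBoundedPiGroup π B ↔ ∃ n ∈ Nat.factoredNumbers π, ∀ b ∈ B, n • b = 0 := by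
  refine exists_congr fun n => ?_
  rw [← and_assoc]
  refine and_congr_left fun _ => ⟨fun h => ?_, fun h => ?_⟩
  · exact Nat.mem_factoredNumbers'.2 h.2
  · exact ⟨Nat.pos_of_ne_zero h.1, Nat.mem_factoredNumbers'.1 h⟩

theorem isBoundedPiGroup_of_finite {A : Type*} [AddCommGroup A] {π : Finset ℕ}
    {B : AddSubgroup A} (hfin : (B : Set A).Finite) (hB : B ≤ piTorsion A π) :
    IsBoundedPiGroup π B := by
  rw [isBoundedPiGroup_iff]
  have key : ∃ n ∈ Nat.factoredNumbers π, ∀ b ∈ (B : Set A), n • b = 0 := by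
    have hB' : (B : Set A) ⊆ piTorsion A π := hB
    generalize (B : Set A) = s at hfin hB'
    induction s, hfin using Set.Finite.induction_on with
    | empty => exact ⟨1, by simp [Nat.mem_factoredNumbers], by simp⟩
    | @insert a s _ _ ih =>
      obtain ⟨n, hn, hs⟩ := ih ((Set.subset_insert _ _).trans hB')
      obtain ⟨k, hk, ha⟩ := mem_piTorsion.1 (hB' (Set.mem_insert a s))
      refine ⟨n * k, Nat.mul_mem_factoredNumbers hn hk, ?_⟩
      rintro b (rfl | hb)
      · rw [mul_smul, ha, smul_zero]
      · rw [mul_comm, mul_smul, hs b hb, smul_zero]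
  exact key

theorem IsBoundedPiGroup.sup {A : Type*} [AddCommGroup A] {π : Finset ℕ}
    {B B' : AddSubgroup A} (hB : IsBoundedPiGroup π B) (hB' : IsBoundedPiGroup π B') :
    IsBoundedPiGroup π (B ⊔ B') := by
  rw [isBoundedPiGroup_iff] at *
  obtain ⟨n, hn, hB⟩ := hB
  obtain ⟨k, hk, hB'⟩ := hB'
  refine ⟨n * k, Nat.mul_mem_factoredNumbers hn hk, fun x hx => ?_⟩
  obtain ⟨b, hb, c, hc, rfl⟩ := AddSubgroup.mem_sup.1 hx
  rw [smul_add, mul_smul n k c, hB' c hc, mul_comm, mul_smul, hB b hb, smul_zero, smul_zero,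
    add_zero]

/-- An element of `ℚ/ℤ` of order exactly `p ^ (h + 1)` generates the `p ^ (h + 1)`-torsion. -/
theorem exists_zsmul_eq_of_prime_pow_smul_eq_zero {p h : ℕ} (hp : p.Prime)
    {u v : AddCircle (1 : ℚ)} (hu : p ^ (h + 1) • u = 0) (hv : p ^ (h + 1) • v = 0)
    (hv' : p ^ h • v ≠ 0) : ∃ k : ℤ, k • v = u := by
  obtain ⟨r, rfl⟩ := QuotientAddGroup.mk_surjective u
  obtain ⟨s, rfl⟩ := QuotientAddGroup.mk_surjective v
  have hp0 : (p : ℚ) ≠ 0 := Nat.cast_ne_zero.2 hp.ne_zero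
  obtain ⟨a, ha⟩ := (AddCircle.coe_eq_zero_iff (1 : ℚ) (x := p ^ (h + 1) • r)).1 hu
  obtain ⟨b, hb⟩ := (AddCircle.coe_eq_zero_iff (1 : ℚ) (x := p ^ (h + 1) • s)).1 hv
  simp only [zsmul_eq_mul, mul_one, nsmul_eq_mul, Nat.cast_pow] at ha hb
  have hbp : ¬ (p : ℤ) ∣ b := by
    rintro ⟨c, rfl⟩
    refine hv' ((AddCircle.coe_eq_zero_iff (1 : ℚ) (x := p ^ h • s)).2 ⟨c, ?_⟩)
    simp only [zsmul_eq_mul, mul_one, nsmul_eq_mul, Nat.cast_pow]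
    push_cast at hb
    apply mul_left_cancel₀ hp0
    rw [hb]; ring
  have hcop : IsCoprime b ((p : ℤ) ^ (h + 1)) := by
    refine IsCoprime.pow_right (IsCoprime.symm ?_)
    exact (Nat.prime_iff_prime_int.1 hp).coprime_iff_not_dvd.2 hbp
  obtain ⟨c, d, hcd⟩ := hcop
  refine ⟨a * c, ?_⟩
  rw [← sub_eq_zero]
  refine (AddCircle.coe_eq_zero_iff (1 : ℚ) (x := (a * c) • s - r)).2 ⟨-(a * d), ?_⟩
  have hcd' : (c : ℚ) * b + d * p ^ (h + 1) = 1 := by exact_mod_cast hcd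
  simp only [zsmul_eq_mul, mul_one]
  push_cast
  apply mul_left_cancel₀ (pow_ne_zero (h + 1) hp0)
  linear_combination (-(a : ℚ)) * hcd' - ha + a * c * hb

/-- A cyclic subgroup of order `p ^ (h + 1)` whose socle has height exactly `h` is a direct
summand. -/
theorem exists_compl_zmultiples {A : Type*} [AddCommGroup A] {H : AddSubgroup A} {p h : ℕ}
    (hp : p.Prime) {y : A} (hy : y ∈ H) (hy0 : p ^ (h + 1) • y = 0)
    (hh : ¬ ∃ z ∈ H, p ^ (h + 1) • z = p ^ h • y) :
    ∃ K : AddSubgroup A, Disjoint (AddSubgroup.zmultiples y) K ∧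
      AddSubgroup.zmultiples y ⊔ K = H := by
  set P := H.map (nsmulAddMonoidHom (p ^ (h + 1))) with hP
  have hne : (QuotientAddGroup.mk (p ^ h • y) : A ⧸ P) ≠ 0 := by
    rw [Ne, QuotientAddGroup.eq_zero_iff]
    exact hh
  obtain ⟨c, hc⟩ := CharacterModule.exists_character_apply_ne_zero_of_ne_zero hne
  obtain ⟨χ, hχ⟩ : ∃ χ : A →+ AddCircle (1 : ℚ), ∀ x, χ x = c (QuotientAddGroup.mk x) :=
    ⟨AddMonoidHom.comp c (QuotientAddGroup.mk' P), fun _ => rfl⟩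
  have hχP : ∀ t ∈ H, p ^ (h + 1) • χ t = 0 := by
    intro t ht
    have : (QuotientAddGroup.mk (p ^ (h + 1) • t) : A ⧸ P) = 0 :=
      (QuotientAddGroup.eq_zero_iff _).2 ⟨t, ht, rfl⟩
    rw [← map_nsmul, hχ, this, map_zero]
  have hχy : p ^ h • χ y ≠ 0 := by rwa [← map_nsmul, hχ]
  have := Fact.mk hp
  have hord : addOrderOf (χ y) = p ^ (h + 1) := addOrderOf_eq_prime_pow hχy (hχP y hy)
  refine ⟨H ⊓ χ.ker, ?_, le_antisymm (sup_le ?_ inf_le_left) ?_⟩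
  · rw [AddSubgroup.disjoint_def]
    rintro _ ⟨k, rfl⟩ ⟨-, hk⟩
    have hk' : k • χ y = 0 := by simpa using hk
    rw [← addOrderOf_dvd_iff_zsmul_eq_zero, hord] at hk'
    obtain ⟨l, rfl⟩ := hk'
    show ((p ^ (h + 1) : ℕ) * l : ℤ) • y = 0
    rw [mul_comm, mul_smul, natCast_zsmul, hy0, smul_zero]
  · rwa [AddSubgroup.zmultiples_le]
  · intro t ht
    obtain ⟨k, hk⟩ := exists_zsmul_eq_of_prime_pow_smul_eq_zero hp (hχP t ht) (hχP y hy) hχy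
    refine AddSubgroup.mem_sup.2 ⟨k • y, ⟨k, rfl⟩, t - k • y,
      ⟨H.sub_mem ht (H.zsmul_mem hy k), ?_⟩, by abel⟩
    show t - k • y ∈ χ.ker
    rw [AddMonoidHom.mem_ker, map_sub, map_zsmul, hk, sub_self]

/-- If the `π`-torsion of `H` is bounded, then every finite `π`-subgroup of `H` is contained in a
finite direct summand of `H` which is a `π`-group. -/
theorem exists_finite_summand {A : Type*} [AddCommGroup A] {π : Finset ℕ} {N : ℕ} (hN : N ≠ 0)
    {H S : AddSubgroup A} (hH : ∀ x ∈ H, x ∈ piTorsion A π → N • x = 0)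
    (hS : (S : Set A).Finite) (hSH : S ≤ H) (hSπ : S ≤ piTorsion A π) :
    ∃ G K : AddSubgroup A, Disjoint G K ∧ G ⊔ K = H ∧ S ≤ G ∧ (G : Set A).Finite ∧
      G ≤ piTorsion A π := by
  induction hn : Nat.card S using Nat.strong_induction_on generalizing H S with
  | _ n ih =>
  subst hn
  have : Finite S := hS
  rcases eq_or_ne S ⊥ with rfl | hSne
  · exact ⟨⊥, H, disjoint_bot_left, bot_sup_eq H, le_rfl, hS, bot_le⟩
  have hcard : Nat.card S ≠ 1 := by rwa [Ne, AddSubgroup.card_eq_one]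
  obtain ⟨p, hp, hpS⟩ := Nat.exists_prime_and_dvd hcard
  have := Fact.mk hp
  obtain ⟨⟨x, hxS⟩, hx⟩ := exists_prime_addOrderOf_dvd_card' p hpS
  have hpx : p • x = 0 := by
    have := addOrderOf_nsmul_eq_zero (⟨x, hxS⟩ : S)
    rw [hx] at this
    exact congrArg Subtype.val this
  have hx0 : x ≠ 0 := by
    rintro rfl
    rw [show (⟨0, hxS⟩ : S) = 0 from rfl, addOrderOf_zero] at hx
    exact hp.one_lt.ne hx
  have hcopx : ∀ u : ℕ, p.Coprime u → u • x ≠ 0 := fun u hu hux => hx0 <| by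
    have h1 := addOrderOf_dvd_of_nsmul_eq_zero hpx
    have h2 := addOrderOf_dvd_of_nsmul_eq_zero hux
    exact AddMonoid.addOrderOf_eq_one_iff.1 (Nat.eq_one_of_dvd_coprimes hu h1 h2)
  have hpπ : p ∈ π := by
    obtain ⟨n, hn, hnx⟩ := mem_piTorsion.1 (hSπ hxS)
    by_contra hpπ
    exact hcopx n ((hp.coprime_iff_not_dvd).2 fun h =>
      hpπ (Nat.mem_factoredNumbers'.1 hn p hp h)) hnx
  have hheight : ∃ h, ¬ ∃ z ∈ H, p ^ h • z = x := by
    obtain ⟨k, u, hu, rfl⟩ := Nat.exists_eq_pow_mul_and_not_dvd hN p hp.ne_one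
    refine ⟨k, ?_⟩
    rintro ⟨z, hz, hzx⟩
    have hzπ : z ∈ piTorsion A π :=
      mem_piTorsion_of_prime_pow_smul_eq_zero hp hpπ (k := k + 1)
        (by rw [pow_succ', mul_smul, hzx, hpx])
    refine hcopx u ((hp.coprime_iff_not_dvd).2 hu) ?_
    rw [← hzx, ← mul_smul, mul_comm]
    exact hH z hz hzπ
  classical
  obtain ⟨h, hh, hmin⟩ : ∃ h, (¬ ∃ z ∈ H, p ^ h • z = x) ∧ ∀ k < h, ∃ z ∈ H, p ^ k • z = x :=
    ⟨Nat.find hheight, Nat.find_spec hheight, fun k hk => not_not.1 (Nat.find_min hheight hk)⟩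
  obtain _ | h := h
  · exact absurd ⟨x, hSH hxS, by simp⟩ hh
  obtain ⟨y, hyH, rfl⟩ := hmin h h.lt_succ_self
  have hy0 : p ^ (h + 1) • y = 0 := by rw [pow_succ', mul_smul, hpx]
  obtain ⟨K₁, hdis, hsup⟩ := exists_compl_zmultiples hp hyH hy0 hh
  set Y := AddSubgroup.zmultiples y with hY
  have hYπ : Y ≤ piTorsion A π := by
    rw [hY, AddSubgroup.zmultiples_le]
    exact mem_piTorsion_of_prime_pow_smul_eq_zero hp hpπ hy0
  have hYfin : (Y : Set A).Finite := by
    rw [hY, AddSubgroup.coe_zmultiples]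
    exact finite_zmultiples.2
      (isOfFinAddOrder_iff_nsmul_eq_zero.2 ⟨_, pow_pos hp.pos _, hy0⟩)
  have hKH : K₁ ≤ H := hsup ▸ le_sup_right
  set S' := (S ⊔ Y) ⊓ K₁ with hS'
  have hmod : Y ⊔ S' = S ⊔ Y := by
    rw [hS', inf_comm, ← sup_inf_assoc_of_le _ (le_sup_right : Y ≤ S ⊔ Y), hsup]
    exact inf_eq_right.2 (sup_le hSH (hsup ▸ le_sup_left))
  have hdisS' : Y ⊓ S' = ⊥ := (hdis.mono_right inf_le_right).eq_bot
  have hcardS' : Nat.card S' = Y.relIndex S := by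
    rw [← AddSubgroup.relIndex_bot_left, ← hdisS', AddSubgroup.inf_relIndex_right,
      ← AddSubgroup.relIndex_sup_left, hmod, AddSubgroup.relIndex_sup_right]
  have hcardS : Nat.card (Y ⊓ S : AddSubgroup A) * Nat.card S' = Nat.card S := by
    rw [hcardS', ← AddSubgroup.inf_relIndex_right, ← AddSubgroup.relIndex_bot_left,
      ← AddSubgroup.relIndex_bot_left, AddSubgroup.relIndex_mul_relIndex _ _ _ bot_le inf_le_right]
  have hSpos : 0 < Nat.card S := Nat.card_pos
  have hYS : Nat.card (Y ⊓ S : AddSubgroup A) ≠ 1 := by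
    rw [Ne, AddSubgroup.card_eq_one, AddSubgroup.eq_bot_iff_forall]
    exact fun hbot => hx0 (hbot _ ⟨Y.nsmul_mem (AddSubgroup.mem_zmultiples y) _, hxS⟩)
  have hS'0 : Nat.card S' ≠ 0 := fun h0 => by
    rw [h0, mul_zero] at hcardS; omega
  have hlt : Nat.card S' < Nat.card S := by
    have hYS0 : Nat.card (Y ⊓ S : AddSubgroup A) ≠ 0 := fun h0 => by
      rw [h0, zero_mul] at hcardS; omega
    rw [← hcardS]
    exact lt_mul_of_one_lt_left (Nat.pos_of_ne_zero hS'0) (by omega)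
  obtain ⟨G, K, hGK, hGKs, hSG, hGf, hGπ⟩ := ih _ hlt
    (fun x hx => hH x (hKH hx)) (Nat.finite_of_card_ne_zero hS'0) inf_le_right
    (inf_le_left.trans (sup_le hSπ hYπ)) rfl
  refine ⟨Y ⊔ G, K, ?_, by rw [sup_assoc, hGKs, hsup], ?_, ?_, sup_le hYπ hGπ⟩
  · rw [← hGKs] at hdis
    exact hGK.disjoint_sup_left_of_disjoint_sup_right hdis
  · calc S ≤ S ⊔ Y := le_sup_left
      _ = Y ⊔ S' := hmod.symm
      _ ≤ Y ⊔ G := sup_le_sup_left hSG Y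
  · rw [AddSubgroup.add_normal]
    exact hYfin.add hGf

/-- If `C ⊔ B` has finite index, `B` is bounded and meets `C` trivially, then up to a finite group
`B` splits off, with complement a finite extension of `C`. -/
theorem exists_isCompl_of_finite_index {A : Type*} [AddCommGroup A] {π : Finset ℕ}
    {B₀ C₀ : AddSubgroup A} (hidx : (B₀ ⊔ C₀).index ≠ 0) (hinf : B₀ ⊓ C₀ = ⊥)
    (hB₀ : IsBoundedPiGroup π B₀) :
    ∃ B₁ A₁ : AddSubgroup A, IsCompl B₁ A₁ ∧ B₁ ≤ B₀ ∧ C₀ ≤ A₁ ∧ C₀.relIndex A₁ ≠ 0 := by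
  obtain ⟨n, hn, hnB⟩ := isBoundedPiGroup_iff.1 hB₀
  have hn0 := Nat.ne_zero_of_mem_factoredNumbers hn
  have htors : IsAddTorsion (A ⧸ C₀) := by
    intro x
    obtain ⟨a, rfl⟩ := QuotientAddGroup.mk_surjective x
    rw [isOfFinAddOrder_iff_nsmul_eq_zero]
    refine ⟨n * (B₀ ⊔ C₀).index, Nat.pos_of_ne_zero (mul_ne_zero hn0 hidx), ?_⟩
    obtain ⟨b, hb, c, hc, hbc⟩ := AddSubgroup.mem_sup.1 ((B₀ ⊔ C₀).nsmul_index_mem a)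
    rw [mul_smul, ← QuotientAddGroup.mk_nsmul, ← QuotientAddGroup.mk_nsmul, ← hbc, smul_add,
      hnB b hb, zero_add]
    exact (QuotientAddGroup.eq_zero_iff _).2 (C₀.nsmul_mem hc n)
  have : (B₀ ⊔ C₀).FiniteIndex := ⟨hidx⟩
  have : Finite (A ⧸ (B₀ ⊔ C₀)) := inferInstance
  set R : Set A := Set.range (Quotient.out : A ⧸ (B₀ ⊔ C₀) → A) with hR
  have hRfin : R.Finite := Set.finite_range (ι := A ⧸ (B₀ ⊔ C₀)) _
  set E := AddSubgroup.closure R ⊔ C₀ with hE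
  have htop : B₀ ⊔ E = ⊤ := by
    refine eq_top_iff.2 fun a _ => ?_
    have hd : -(Quotient.out (QuotientAddGroup.mk a : A ⧸ (B₀ ⊔ C₀))) + a ∈ B₀ ⊔ C₀ :=
      QuotientAddGroup.eq.1 (Quotient.out_eq _)
    have h1 : Quotient.out (QuotientAddGroup.mk a : A ⧸ (B₀ ⊔ C₀)) ∈ B₀ ⊔ E :=
      (le_sup_left.trans le_sup_right : AddSubgroup.closure R ≤ B₀ ⊔ E)
        (AddSubgroup.subset_closure ⟨_, rfl⟩)
    have h2 := (sup_le_sup_left le_sup_right B₀ : B₀ ⊔ C₀ ≤ B₀ ⊔ E) hd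
    simpa using add_mem h1 h2
  have hCE : C₀.relIndex E ≠ 0 := by
    rw [hE, AddSubgroup.relIndex_sup_right]
    have hker := AddSubgroup.relIndex_ker (K := AddSubgroup.closure R) (QuotientAddGroup.mk' C₀)
    rw [QuotientAddGroup.ker_mk'] at hker
    rw [hker, AddMonoidHom.map_closure]
    have : AddGroup.FG (AddSubgroup.closure (QuotientAddGroup.mk' C₀ '' R)) :=
      (AddGroup.fg_iff_addSubgroup_fg _).2
        ⟨(hRfin.image (QuotientAddGroup.mk' C₀)).toFinset, by rw [Set.Finite.coe_toFinset]⟩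
    have := AddCommGroup.finite_of_fg_isAddTorsion
      (AddSubgroup.closure (QuotientAddGroup.mk' C₀ '' R)) (htors.addSubgroup _)
    exact Nat.card_pos.ne'
  have hSfin : ((B₀ ⊓ E : AddSubgroup A) : Set A).Finite := by
    have h := mt (AddSubgroup.relIndex_eq_zero_of_le_right (inf_le_right : B₀ ⊓ E ≤ E)) hCE
    have hbot : C₀ ⊓ (B₀ ⊓ E) = ⊥ := by
      rw [← inf_assoc, inf_comm C₀, hinf, bot_inf_eq]
    rw [← AddSubgroup.inf_relIndex_right, hbot, AddSubgroup.relIndex_bot_left] at h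
    exact Nat.finite_of_card_ne_zero h
  obtain ⟨G, K, hGK, hGKs, hSG, hGfin, -⟩ := exists_finite_summand (π := π) hn0
    (fun x hx _ => hnB x hx) hSfin inf_le_left (fun x hx => ⟨n, hn, hnB x hx.1⟩)
  have hKB : K ≤ B₀ := hGKs ▸ le_sup_right
  have hGB : G ≤ B₀ := hGKs ▸ le_sup_left
  refine ⟨K, E ⊔ G, ⟨?_, ?_⟩, hKB, le_sup_right.trans le_sup_left, ?_⟩
  · rw [AddSubgroup.disjoint_def]
    intro b hb hb'
    obtain ⟨e, he, g, hg, rfl⟩ := AddSubgroup.mem_sup.1 hb'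
    have heB : e ∈ B₀ := by simpa using sub_mem (hKB hb) (hGB hg)
    exact AddSubgroup.disjoint_def.1 hGK (add_mem (hSG ⟨heB, he⟩) hg) hb
  · rw [codisjoint_iff, sup_comm E, ← sup_assoc, sup_comm K, hGKs, htop]
  · refine AddSubgroup.relIndex_ne_zero_trans hCE ?_
    have : Finite G := hGfin
    rw [AddSubgroup.relIndex_sup_left]
    exact ne_zero_of_dvd_ne_zero Nat.card_pos.ne' (AddSubgroup.relIndex_dvd_card E G)

/-- The `π`-torsion of `C` is divisible when its `p`-primary components are `p`-divisible for
every `p ∈ π`. -/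
theorem exists_nsmul_eq_of_mem_inf_piTorsion {A : Type*} [AddCommGroup A] {π : Finset ℕ}
    {C : AddSubgroup A} (hC : ∀ p ∈ π, ∀ x ∈ pPrimary C p, ∃ y ∈ pPrimary C p, p • y = x)
    {n : ℕ} (hn : n ≠ 0) {x : A} (hx : x ∈ C ⊓ piTorsion A π) :
    ∃ y ∈ C ⊓ piTorsion A π, n • y = x := by
  induction n using induction_on_primes generalizing x with
  | zero => exact absurd rfl hn
  | one => exact ⟨x, hx, one_smul _ x⟩
  | prime_mul p n hp ih =>
    obtain ⟨y, hy, rfl⟩ := ih (right_ne_zero_of_mul hn) hx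
    suffices ∃ z ∈ C ⊓ piTorsion A π, p • z = y by
      obtain ⟨z, hz, rfl⟩ := this
      exact ⟨z, hz, by rw [mul_comm, mul_smul]⟩
    obtain ⟨k, hk, hky⟩ := mem_piTorsion.1 hy.2
    obtain ⟨e, u, hu, rfl⟩ := Nat.exists_eq_pow_mul_and_not_dvd
      (Nat.ne_zero_of_mem_factoredNumbers hk) p hp.ne_one
    obtain ⟨a, b, hab⟩ := Nat.isCoprime_iff_coprime.2 ((hp.coprime_iff_not_dvd).2 hu)
    have hy' : p • (a • y) + b • (u • y) = y := by
      rw [← natCast_zsmul, ← natCast_zsmul, ← mul_smul, ← mul_smul, ← add_smul, mul_comm (p : ℤ),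
        hab, one_smul]
    have huy : p ^ e • (b • u • y) = 0 := by
      rw [smul_comm, ← mul_smul (p ^ e), hky, smul_zero]
    by_cases hpπ : p ∈ π
    · obtain ⟨w, hw, hwy⟩ := hC p hpπ (b • u • y)
        ⟨C.zsmul_mem (C.nsmul_mem hy.1 u) b, e, huy⟩
      have hwπ : w ∈ piTorsion A π := by
        obtain ⟨k, hk⟩ := hw.2
        exact mem_piTorsion_of_prime_pow_smul_eq_zero hp hpπ hk
      refine ⟨a • y + w, add_mem (zsmul_mem hy a) ⟨hw.1, hwπ⟩, ?_⟩
      rw [smul_add, hwy, hy']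
    · have he : e = 0 := by
        by_contra he
        exact hpπ (Nat.mem_factoredNumbers'.1 hk p hp ((dvd_pow_self p he).mul_right u))
      subst he
      rw [pow_zero, one_smul] at huy
      exact ⟨a • y, zsmul_mem hy a, by rwa [huy, add_zero] at hy'⟩

/-- The property that the `p`-primary components are `p`-divisible with finite socle, for `p ∈ π`,
passes to a finite extension of `C₀` up to splitting off a finite `π`-group. -/
theorem exists_finite_summand_of_relIndex_ne_zero {A : Type*} [AddCommGroup A] {π : Finset ℕ}
    (hπ : ∀ p ∈ π, p.Prime) {A₁ C₀ : AddSubgroup A} (hle : C₀ ≤ A₁) (hidx : C₀.relIndex A₁ ≠ 0)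
    (hC₀ : ∀ p ∈ π, PDivisibleFiniteSocle C₀ p) :
    ∃ B₂ C : AddSubgroup A, Disjoint B₂ C ∧ B₂ ⊔ C = A₁ ∧ (B₂ : Set A).Finite ∧
      IsBoundedPiGroup π B₂ ∧ ∀ p ∈ π, PDivisibleFiniteSocle C p := by
  set D := C₀ ⊓ piTorsion A π with hD
  have hDA : D ≤ A₁ := inf_le_left.trans hle
  have hdiv : ∀ {n : ℤ}, n ≠ 0 → Function.Surjective (fun a : D => n • a) := by
    rintro n hn ⟨x, hx⟩
    obtain ⟨y, hy, hyx⟩ := exists_nsmul_eq_of_mem_inf_piTorsion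
      (fun p hp => (hC₀ p hp).1) (Int.natAbs_ne_zero.2 hn) hx
    rcases Int.natAbs_eq n with h | h
    · exact ⟨⟨y, hy⟩, Subtype.ext <| by
        rw [h]; simpa only [natCast_zsmul, AddSubgroup.coe_nsmul] using hyx⟩
    · exact ⟨-⟨y, hy⟩, Subtype.ext <| by
        rw [h]
        simpa only [neg_smul_neg, natCast_zsmul, AddSubgroup.coe_nsmul] using hyx⟩
  let : DivisibleBy D ℤ := divisibleByOfSMulRightSurj D ℤ hdiv
  obtain ⟨r, hr⟩ := (Module.Baer.of_divisible D).extension_property_addMonoidHom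
    D.subtype D.subtype_injective (AddMonoidHom.id D)
  have hr' : ∀ d (hd : d ∈ D), r d = ⟨d, hd⟩ := fun d hd => DFunLike.congr_fun hr ⟨d, hd⟩
  have hDr : D ⊓ r.ker = ⊥ := (AddSubgroup.eq_bot_iff_forall _).2 fun d hd => by
    have h : d ∈ r.ker := hd.2
    rw [AddMonoidHom.mem_ker, hr' d hd.1] at h
    exact congrArg Subtype.val h
  set A₂ := A₁ ⊓ r.ker with hA₂
  have hDA₂ : D ⊔ A₂ = A₁ := by
    refine le_antisymm (sup_le hDA inf_le_left) fun a ha => ?_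
    refine AddSubgroup.mem_sup.2 ⟨r a, (r a).2, a - r a, ⟨A₁.sub_mem ha (hDA (r a).2), ?_⟩, by abel⟩
    show a - r a ∈ r.ker
    rw [AddMonoidHom.mem_ker, map_sub, hr' _ (r a).2, sub_self]
  set T := A₂ ⊓ piTorsion A π with hT
  have hTfin : (T : Set A).Finite := by
    have h := mt (AddSubgroup.relIndex_eq_zero_of_le_right
      (inf_le_left.trans inf_le_left : T ≤ A₁)) hidx
    have hbot : C₀ ⊓ T = ⊥ := le_bot_iff.1 <| hDr ▸ fun x hx => ⟨⟨hx.1, hx.2.2⟩, hx.2.1.2⟩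
    rw [← AddSubgroup.inf_relIndex_right, hbot, AddSubgroup.relIndex_bot_left] at h
    exact Nat.finite_of_card_ne_zero h
  have : Finite T := hTfin
  obtain ⟨G, K, hGK, hGKs, hTG, hGfin, hGπ⟩ := exists_finite_summand (π := π) (H := A₂)
    (N := Nat.card T) Nat.card_pos.ne'
    (fun x hx hxπ => congrArg Subtype.val (card_nsmul_eq_zero' (x := (⟨x, hx, hxπ⟩ : T))))
    hTfin inf_le_left inf_le_right
  have hCπ : (D ⊔ K) ⊓ piTorsion A π = C₀ ⊓ piTorsion A π := by
    refine le_antisymm (fun x hx => ?_) (le_inf le_sup_left inf_le_right)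
    obtain ⟨⟨d, hd, k, hk, rfl⟩, hxπ⟩ := And.imp_left AddSubgroup.mem_sup.1 hx
    have hkπ : k ∈ piTorsion A π := by simpa using (piTorsion A π).sub_mem hxπ hd.2
    have hk0 : k = 0 := AddSubgroup.disjoint_def.1 hGK
      (hTG ⟨(hGKs ▸ le_sup_right : K ≤ A₂) hk, hkπ⟩) hk
    rwa [hk0, add_zero]
  refine ⟨G, D ⊔ K, ?_, ?_, hGfin, isBoundedPiGroup_of_finite hGfin hGπ, fun p hp => ?_⟩
  · rw [sup_comm]
    refine hGK.disjoint_sup_right_of_disjoint_sup_left ?_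
    rw [hGKs, disjoint_comm, disjoint_iff, eq_bot_iff, ← hDr]
    exact inf_le_inf_left D inf_le_right
  · rw [sup_comm D, ← sup_assoc, hGKs, sup_comm, hDA₂]
  · have hprim : pPrimary (D ⊔ K) p = pPrimary C₀ p := by
      have hpπ : ∀ x : A, (∃ k : ℕ, p ^ k • x = 0) → x ∈ piTorsion A π := by
        rintro x ⟨k, hk⟩
        exact mem_piTorsion_of_prime_pow_smul_eq_zero (hπ p hp) hp hk
      ext x
      refine and_congr_left fun hx => ?_
      have := SetLike.ext_iff.1 hCπ x
      simpa [AddSubgroup.mem_inf, hpπ x hx] using this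
    have h := hC₀ p hp
    rwa [PDivisibleFiniteSocle, ← hprim] at h

/-- The mini-multiplication attached to an integer and a direct decomposition. -/
theorem exists_addMonoidHom_smul_of_isCompl {A : Type*} [AddCommGroup A] {B C : AddSubgroup A}
    (h : IsCompl B C) (m : ℤ) :
    ∃ μ : A →+ A, ∀ b ∈ B, ∀ c ∈ C, μ (b + c) = m • b := by
  have h' : IsCompl (AddSubgroup.toIntSubmodule B) (AddSubgroup.toIntSubmodule C) :=
    (OrderIso.isCompl_iff AddSubgroup.toIntSubmodule).1 h
  refine ⟨(m • Submodule.projection _ _ h').toAddMonoidHom, fun b hb c hc => ?_⟩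
  have h1 := Submodule.projection_apply_of_mem_left h' (x := b) hb
  have h2 := Submodule.projection_apply_of_mem_right h' (x := c) hc
  simp [h1, h2]

/-- If an endomorphism `φ` of an abelian group `A` acts as a
mini-multiplication of type `m ⊕_π 0` on a finite-index subgroup `A₀ = B₀ ⊕ C₀` of `A`,
then `φ` is close (modulo a finitary endomorphism) to a mini-multiplication of type
`m ⊕_π 0` on the whole of `A`. -/
theorem close_to_minimultiplication_of_minimultiplication_on_finite_index
    {A : Type*} [AddCommGroup A] (π : Finset ℕ) (hπ : ∀ p ∈ π, p.Prime) (m : ℤ)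
    (A₀ B₀ C₀ : AddSubgroup A) (hidx : A₀.index ≠ 0)
    (hinf : B₀ ⊓ C₀ = ⊥) (hsup : B₀ ⊔ C₀ = A₀)
    (hB₀ : IsBoundedPiGroup π B₀) (hC₀ : ∀ p ∈ π, PDivisibleFiniteSocle C₀ p)
    (φ : A →+ A) (hφB : ∀ b ∈ B₀, φ b = m • b) (hφC : ∀ c ∈ C₀, φ c = 0) :
    ∃ B C : AddSubgroup A, IsCompl B C ∧ IsBoundedPiGroup π B ∧
      (∀ p ∈ π, PDivisibleFiniteSocle C p) ∧
      ∃ μ : A →+ A, (∀ b ∈ B, ∀ c ∈ C, μ (b + c) = m • b) ∧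
        (Set.range ⇑(φ - μ)).Finite := by
  subst hsup
  obtain ⟨B₁, A₁, hcompl, hBB, hCA, hrel⟩ := exists_isCompl_of_finite_index hidx hinf hB₀
  obtain ⟨B₂, C, hdis, hsup, hfin, hB₂, hC⟩ :=
    exists_finite_summand_of_relIndex_ne_zero hπ hCA hrel hC₀
  have hcompl' : IsCompl (B₁ ⊔ B₂) C := by
    refine ⟨?_, ?_⟩
    · exact hdis.disjoint_sup_left_of_disjoint_sup_right (hsup ▸ hcompl.disjoint)
    · rw [codisjoint_iff, sup_assoc, hsup, hcompl.sup_eq_top]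
  obtain ⟨μ, hμ⟩ := exists_addMonoidHom_smul_of_isCompl hcompl' m
  have hB₁ : IsBoundedPiGroup π B₁ := by
    obtain ⟨n, hn, hnπ, hnB⟩ := hB₀
    exact ⟨n, hn, hnπ, fun b hb => hnB b (hBB hb)⟩
  refine ⟨B₁ ⊔ B₂, C, hcompl', hB₁.sup hB₂, hC, μ, hμ, ?_⟩
  have hker₁ : B₁ ≤ (φ - μ).ker := fun b hb => by
    have h := hμ b (le_sup_left (b := B₂) hb) 0 C.zero_mem
    rw [add_zero] at h
    rw [AddMonoidHom.mem_ker, AddMonoidHom.sub_apply, hφB b (hBB hb), h, sub_self]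
  have hker₂ : C₀ ⊓ C ≤ (φ - μ).ker := fun c hc => by
    have h := hμ 0 (zero_mem _) c hc.2
    rw [zero_add, smul_zero] at h
    rw [AddMonoidHom.mem_ker, AddMonoidHom.sub_apply, hφC c hc.1, h, sub_self]
  have hCA₁ : C.relIndex A₁ ≠ 0 := by
    have : Finite B₂ := hfin
    rw [← hsup, AddSubgroup.relIndex_sup_right]
    exact ne_zero_of_dvd_ne_zero Nat.card_pos.ne' (AddSubgroup.relIndex_dvd_card C B₂)
  have hidx' : (φ - μ).ker.index ≠ 0 := by
    have htop : A₁ ⊔ (φ - μ).ker = ⊤ :=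
      top_le_iff.1 (hcompl.symm.sup_eq_top ▸ sup_le_sup_left hker₁ A₁)
    rw [← AddSubgroup.relIndex_top_right, ← htop, AddSubgroup.relIndex_sup_right]
    exact ne_zero_of_dvd_ne_zero (AddSubgroup.relIndex_inf_ne_zero hrel hCA₁)
      (AddSubgroup.relIndex_dvd_of_le_left A₁ hker₂)
  rw [AddSubgroup.index_ker] at hidx'
  exact Nat.finite_of_card_ne_zero hidx'
end
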